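/- arXiv:1003.4605 — 3 statements merged into one kernel-verified Lean document; each statement's English description precedes it below -/
import Mathlib

section
/- There exists an integer N ≥ 1 such that every nonzero psd element f of ℝ[C] satisfies θ(f) ≤ N + ⌈δ(f)/2⌉. -/
open Polynomial

noncomputable section

/-- The defining polynomial `y² + q(x)` of the curve, as a polynomial in `y`
over `ℝ[x]`. -/
def curvePoly (q : Polynomial ℝ) : Polynomial (Polynomial ℝ) :=
  X ^ 2 + C q

lemma curvePoly_monic (q : Polynomial ℝ) : (curvePoly q).Monic :=
  Polynomial.monic_X_pow_add_C q (by norm_num)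

/-- The coordinate ring `ℝ[C] = ℝ[x,y]/(y² + q(x))`. -/
abbrev CurveRing (q : Polynomial ℝ) : Type := AdjoinRoot (curvePoly q)

/-- The unique representative `a(x) + b(x)·y` (of `y`-degree `< 2`) of an element. -/
def curveRep (q : Polynomial ℝ) (f : CurveRing q) : Polynomial (Polynomial ℝ) :=
  AdjoinRoot.modByMonicHom (curvePoly_monic q) f

/-- The polynomial `a(x)` with `f = a(x) + b(x)·y`. -/
def repA (q : Polynomial ℝ) (f : CurveRing q) : Polynomial ℝ := (curveRep q f).coeff 0

/-- The polynomial `b(x)` with `f = a(x) + b(x)·y`. -/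
def repB (q : Polynomial ℝ) (f : CurveRing q) : Polynomial ℝ := (curveRep q f).coeff 1

/-- `δ(f) = max (deg a, 2 + deg b)` for `f = a(x) + b(x)·y ≠ 0`. -/
def curveDelta (q : Polynomial ℝ) (f : CurveRing q) : ℕ :=
  if repB q f = 0 then (repA q f).natDegree
  else max (repA q f).natDegree (2 + (repB q f).natDegree)

/-- `f ∈ ℝ[C]` is psd: nonnegative at all real points of the curve. -/
def IsPsd (q : Polynomial ℝ) (f : CurveRing q) : Prop :=
  ∀ u v : ℝ, v ^ 2 + q.eval u = 0 → 0 ≤ (repA q f).eval u + (repB q f).eval u * v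

/-- `f` is a sum of squares of elements of `δ`-degree at most `d`. -/
def IsSosLe (q : Polynomial ℝ) (f : CurveRing q) (d : ℕ) : Prop :=
  ∃ (r : ℕ) (g : Fin r → CurveRing q), f = ∑ i, g i ^ 2 ∧ ∀ i, curveDelta q (g i) ≤ d

/-- `θ(f)`: the least `d` such that `f` is a sum of squares of elements of
`δ`-degree `≤ d`, and `∞` if `f` is not a sum of squares. -/
def curveTheta (q : Polynomial ℝ) (f : CurveRing q) : ℕ∞ :=
  sInf {d : ℕ∞ | ∃ n : ℕ, d = (n : ℕ∞) ∧ IsSosLe q f n}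

/-- All zeros of `f` on `C(ℂ)` are real. -/
def AllZerosReal (q : Polynomial ℝ) (f : CurveRing q) : Prop :=
  ∀ u v : ℂ, v ^ 2 + (q.map (algebraMap ℝ ℂ)).eval u = 0 →
    ((repA q f).map (algebraMap ℝ ℂ)).eval u +
      ((repB q f).map (algebraMap ℝ ℂ)).eval u * v = 0 →
    u.im = 0 ∧ v.im = 0

/-- Coefficient polynomials of the affine genus one curves `y² + q(x) = 0` under consideration. -/
class SmoothQuartic (q : ℝ[X]) : Prop where
  monic : q.Monic
  natDegree_eq : q.natDegree = 4
  simple_root : ∀ c : ℝ, q.eval c = 0 → ∃ r : ℝ[X], q = (X - C c) * r ∧ r.eval c ≠ 0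
  exists_neg : ∃ x : ℝ, q.eval x < 0

/-- A model of `ℝ[x,y]/(y² + q(x))` in which elements are pairs `a + b y`. -/
abbrev CurveAlg (q : ℝ[X]) : Type := QuadraticAlgebra ℝ[X] (-q) 0

namespace CurveAlg

open QuadraticAlgebra

variable {q : ℝ[X]}

lemma norm_eq (f : CurveAlg q) : f.norm = f.re ^ 2 + q * f.im ^ 2 := by
  rw [norm_def]; ring

lemma norm_algebraMap_eq (r : ℝ[X]) : (algebraMap ℝ[X] (CurveAlg q) r).norm = r ^ 2 :=
  norm_algebraMap r

section Degree

variable [hq : SmoothQuartic q]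

lemma degree_norm {f : CurveAlg q} (hf : f ≠ 0) :
    f.norm.degree = max (2 * f.re.degree) (4 + 2 * f.im.degree) := by
  have h4 : q.degree = 4 := by
    rw [degree_eq_natDegree hq.monic.ne_zero, hq.natDegree_eq]; rfl
  rw [norm_eq, degree_add_eq_of_leadingCoeff_add_ne_zero]
  · rw [degree_mul, degree_pow, degree_pow, h4]; simp
  · rw [leadingCoeff_mul, hq.monic.leadingCoeff, leadingCoeff_pow, leadingCoeff_pow, one_mul]
    intro h
    apply hf
    have h1 : f.re.leadingCoeff = 0 := by nlinarith [sq_nonneg f.im.leadingCoeff]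
    have h2 : f.im.leadingCoeff = 0 := by nlinarith [sq_nonneg f.re.leadingCoeff]
    ext1
    · simpa using h1
    · simpa using h2

lemma norm_ne_zero {f : CurveAlg q} (hf : f ≠ 0) : f.norm ≠ 0 := by
  intro h
  have h1 := degree_norm hf
  rw [h, degree_zero] at h1
  have h2 := (max_eq_bot.1 h1.symm)
  apply hf
  ext1
  · by_contra h3
    rw [re_zero] at h3
    rw [degree_eq_natDegree h3] at h2
    have := h2.1
    norm_cast at this
  · by_contra h3
    rw [im_zero] at h3
    rw [degree_eq_natDegree h3] at h2
    have := h2.2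
    norm_cast at this

lemma norm_eq_zero_iff {f : CurveAlg q} : f.norm = 0 ↔ f = 0 :=
  ⟨fun h => by_contra fun hf => norm_ne_zero hf h, fun h => by rw [h, QuadraticAlgebra.norm_zero]⟩

instance : IsDomain (CurveAlg q) :=
  haveI : NoZeroDivisors (CurveAlg q) := ⟨fun {f g} h => by
    rw [← norm_eq_zero_iff (q := q), ← norm_eq_zero_iff (f := g), ← mul_eq_zero, ← map_mul, h,
      QuadraticAlgebra.norm_zero]⟩
  NoZeroDivisors.to_isDomain _

end Degree

/-- The space of elements of `δ`-degree at most `d`. -/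
def degreeLE (q : ℝ[X]) (d : ℕ) : Submodule ℝ (CurveAlg q) where
  carrier := {f | f.re ∈ degreeLT ℝ (d + 1) ∧ f.im ∈ degreeLT ℝ (d - 1)}
  add_mem' ha hb := ⟨add_mem ha.1 hb.1, add_mem ha.2 hb.2⟩
  zero_mem' := ⟨zero_mem _, zero_mem _⟩
  smul_mem' c _ ha := ⟨Submodule.smul_mem _ c ha.1, Submodule.smul_mem _ c ha.2⟩

lemma mem_degreeLE_iff {d : ℕ} {f : CurveAlg q} :
    f ∈ degreeLE q d ↔ f.re ∈ degreeLT ℝ (d + 1) ∧ f.im ∈ degreeLT ℝ (d - 1) := Iff.rfl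

/-- The coordinates of an element of `degreeLE q d`. -/
def degreeLEEquiv (q : ℝ[X]) (d : ℕ) :
    degreeLE q d ≃ₗ[ℝ] degreeLT ℝ (d + 1) × degreeLT ℝ (d - 1) where
  toFun f := (⟨f.1.re, f.2.1⟩, ⟨f.1.im, f.2.2⟩)
  invFun g := ⟨⟨g.1.1, g.2.1⟩, g.1.2, g.2.2⟩
  map_add' _ _ := rfl
  map_smul' _ _ := rfl
  left_inv _ := rfl
  right_inv _ := rfl

instance (d : ℕ) : FiniteDimensional ℝ (degreeLT ℝ d) :=
  Module.Finite.equiv (degreeLTEquiv ℝ d).symm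

instance (d : ℕ) : FiniteDimensional ℝ (degreeLE q d) :=
  Module.Finite.equiv (degreeLEEquiv q d).symm

lemma finrank_degreeLE {d : ℕ} (hd : 1 ≤ d) : Module.finrank ℝ (degreeLE q d) = 2 * d := by
  rw [(degreeLEEquiv q d).finrank_eq, Module.finrank_prod, (degreeLTEquiv ℝ _).finrank_eq,
    (degreeLTEquiv ℝ _).finrank_eq, Module.finrank_fin_fun, Module.finrank_fin_fun]
  omega

lemma mem_degreeLE_iff_natDegree_norm [hq : SmoothQuartic q] {d : ℕ} {f : CurveAlg q} :
    f ∈ degreeLE q d ↔ f.norm.natDegree ≤ 2 * d := by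
  rcases eq_or_ne f 0 with rfl | hf
  · simp [QuadraticAlgebra.norm_zero]
  rw [natDegree_le_iff_degree_le, degree_norm hf, mem_degreeLE_iff, mem_degreeLT, mem_degreeLT,
    max_le_iff]
  apply and_congr
  · rcases eq_or_ne f.re 0 with h | h
    · simp [h]
    · rw [degree_eq_natDegree h]; norm_cast; omega
  · rcases eq_or_ne f.im 0 with h | h
    · simp [h]
    · rw [degree_eq_natDegree h]; norm_cast; omega

lemma mul_mem_degreeLE [SmoothQuartic q] {d e : ℕ} {f g : CurveAlg q} (hf : f ∈ degreeLE q d)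
    (hg : g ∈ degreeLE q e) : f * g ∈ degreeLE q (d + e) := by
  rw [mem_degreeLE_iff_natDegree_norm] at *
  rw [map_mul]
  exact natDegree_mul_le.trans (by omega)

/-- The real points of the curve. -/
abbrev Pt (q : ℝ[X]) : Type := {p : ℝ × ℝ // p.2 ^ 2 + q.eval p.1 = 0}

/-- Evaluation at a real point. -/
def ev (p : Pt q) : CurveAlg q →ₐ[ℝ] ℝ where
  toFun f := f.re.eval p.1.1 + f.im.eval p.1.1 * p.1.2
  map_one' := by simp [QuadraticAlgebra.re_one, QuadraticAlgebra.im_one]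
  map_mul' f g := by
    have := p.2
    simp only [re_mul, im_mul, eval_add, eval_mul, eval_neg, zero_mul, add_zero]
    linear_combination (f.im.eval p.1.1 * g.im.eval p.1.1) * -this
  map_zero' := by simp
  map_add' f g := by simp; ring
  commutes' r := by
    have : algebraMap ℝ (CurveAlg q) r = ⟨C r, 0⟩ := rfl
    simp [this]

lemma ev_apply (p : Pt q) (f : CurveAlg q) :
    ev p f = f.re.eval p.1.1 + f.im.eval p.1.1 * p.1.2 := rfl

@[simp] lemma ev_algebraMap (p : Pt q) (r : ℝ[X]) :
    ev p (algebraMap ℝ[X] (CurveAlg q) r) = r.eval p.1.1 := by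
  simp [ev_apply, QuadraticAlgebra.algebraMap_eq]

@[simp] lemma ev_omega (p : Pt q) : ev p (omega : CurveAlg q) = p.1.2 := by
  simp [ev_apply]

/-- The conjugate `(u, -v)` of the point `(u, v)` under `y ↦ -y`. -/
def conj (p : Pt q) : Pt q := ⟨(p.1.1, -p.1.2), by simpa using p.2⟩

lemma ev_conj_star (p : Pt q) (f : CurveAlg q) : ev (conj p) (star f) = ev p f := by
  simp [ev_apply, conj]

lemma conj_conj (p : Pt q) : conj (conj p) = p := by
  simp [conj]

lemma conj_eq_self {p : Pt q} (h : p.1.2 = 0) : conj p = p :=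
  Subtype.ext (Prod.ext rfl (by simp [conj, h]))

lemma eq_or_eq_conj {p p' : Pt q} (h : p'.1.1 = p.1.1) : p' = p ∨ p' = conj p := by
  have h1 : p'.1.2 ^ 2 = p.1.2 ^ 2 := by
    have := p.2; have := p'.2; rw [h] at this; linarith
  rcases sq_eq_sq_iff_eq_or_eq_neg.1 h1 with h2 | h2
  · exact Or.inl (Subtype.ext (Prod.ext h h2))
  · exact Or.inr (Subtype.ext (Prod.ext h h2))

lemma algebraMap_X_sub_C_dvd {c : ℝ} {f : CurveAlg q} :
    algebraMap ℝ[X] (CurveAlg q) (X - C c) ∣ f ↔ f.re.eval c = 0 ∧ f.im.eval c = 0 := by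
  rw [algebraMap_dvd_iff, dvd_iff_isRoot, dvd_iff_isRoot]; rfl

lemma omega_sq : (omega : CurveAlg q) ^ 2 = algebraMap ℝ[X] _ (-q) := by
  rw [sq, omega_mul_omega_eq_mk]; rfl

/-- A uniformizer at a real point of the curve. -/
def unif (p : Pt q) : CurveAlg q :=
  if p.1.2 = 0 then omega else algebraMap ℝ[X] _ (X - C p.1.1)

lemma ev_unif (p : Pt q) : ev p (unif p) = 0 := by
  unfold unif
  split_ifs with h
  · simpa using h
  · simp

lemma unif_ne_zero (p : Pt q) : unif p ≠ 0 := by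
  unfold unif
  split_ifs with h
  · intro h; simpa using congrArg im h
  · rw [Ne, map_eq_zero_iff _ algebraMap_injective]
    exact X_sub_C_ne_zero _

/-- `h` vanishes to order exactly `k` at `p`. -/
def HasOrder (p : Pt q) (h : CurveAlg q) (k : ℕ) : Prop :=
  ∃ s r : CurveAlg q, ev p s ≠ 0 ∧ ev p r ≠ 0 ∧ s * h = r * unif p ^ k

lemma HasOrder.mul {p : Pt q} {h h' : CurveAlg q} {k k' : ℕ} :
    HasOrder p h k → HasOrder p h' k' → HasOrder p (h * h') (k + k') := by
  rintro ⟨s, r, hs, hr, e⟩ ⟨s', r', hs', hr', e'⟩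
  refine ⟨s * s', r * r', by simp [hs, hs'], by simp [hr, hr'], ?_⟩
  linear_combination s' * h' * e + r * unif p ^ k * e'

lemma hasOrder_zero {p : Pt q} {h : CurveAlg q} (hh : ev p h ≠ 0) : HasOrder p h 0 :=
  ⟨1, h, by simp, hh, by simp⟩

lemma HasOrder.pow {p : Pt q} {h : CurveAlg q} {k : ℕ} (hk : HasOrder p h k) (n : ℕ) :
    HasOrder p (h ^ n) (n * k) := by
  induction n with
  | zero => simpa using hasOrder_zero (p := p) (h := 1) (by simp)
  | succ n ih => rw [pow_succ, add_mul, one_mul]; exact ih.mul hk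

lemma HasOrder.star {p : Pt q} {h : CurveAlg q} {k : ℕ} :
    HasOrder p h k → HasOrder (conj p) (star h) k := by
  rintro ⟨s, r, hs, hr, e⟩
  by_cases hv : p.1.2 = 0
  · refine ⟨Star.star s, Star.star r * (-1) ^ k, by rwa [ev_conj_star], ?_, ?_⟩
    · rw [map_mul, ev_conj_star]; simpa using hr
    · have hu : unif (conj p) = omega := by simp [unif, conj, hv]
      have hu' : unif p = omega := by simp [unif, hv]
      have hs : Star.star (omega : CurveAlg q) = -omega := by ext1 <;> simp
      have := congrArg Star.star e
      simp only [star_mul', star_pow, hu', hs] at this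
      rw [this, hu, neg_pow, mul_assoc]
  · refine ⟨Star.star s, Star.star r, by rwa [ev_conj_star], by rwa [ev_conj_star], ?_⟩
    have hu : unif (conj p) = unif p := by simp [unif, conj, hv]
    have hs : Star.star (unif p) = unif p := by
      simp only [unif, if_neg hv]; ext1 <;> simp [QuadraticAlgebra.algebraMap_eq]
    have := congrArg Star.star e
    simpa only [star_mul', star_pow, hs, hu] using this

/-- The elements vanishing to order at least `e` at `p`. -/
def vanishing (p : Pt q) (e : ℕ) : Submodule ℝ (CurveAlg q) where
  carrier := {h | ∃ s, ev p s ≠ 0 ∧ unif p ^ e ∣ s * h}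
  zero_mem' := ⟨1, by simp, by simp⟩
  add_mem' := by
    rintro a b ⟨s, hs, hd⟩ ⟨s', hs', hd'⟩
    refine ⟨s * s', by simp [hs, hs'], ?_⟩
    rw [show s * s' * (a + b) = s' * (s * a) + s * (s' * b) by ring]
    exact dvd_add (hd.mul_left _) (hd'.mul_left _)
  smul_mem' := by
    rintro c a ⟨s, hs, hd⟩
    obtain ⟨t, ht⟩ := hd
    exact ⟨s, hs, c • t, by rw [mul_smul_comm, ht, mul_smul_comm]⟩

lemma vanishing_zero (p : Pt q) : vanishing p 0 = ⊤ :=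
  eq_top_iff.2 fun _ _ => ⟨1, by simp, by simp⟩

section Order

variable [hq : SmoothQuartic q]

lemma HasOrder.mem_vanishing_iff {p : Pt q} {h : CurveAlg q} {k e : ℕ} (hk : HasOrder p h k) :
    h ∈ vanishing p e ↔ e ≤ k := by
  obtain ⟨s, r, hs, hr, he⟩ := hk
  constructor
  · rintro ⟨s', hs', t, ht⟩
    by_contra hlt
    obtain ⟨j, rfl⟩ := Nat.exists_eq_add_of_lt (not_le.1 hlt)
    have h1 : unif p ^ k * (s' * r) = unif p ^ k * (s * t * unif p ^ (j + 1)) := by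
      linear_combination s * ht - s' * he
    have h2 := mul_left_cancel₀ (pow_ne_zero _ (unif_ne_zero p)) h1
    have h3 := congrArg (ev p) h2
    simp only [map_mul, map_pow, ev_unif] at h3
    simp [hs', hr] at h3
  · intro hle
    exact ⟨s, hs, he ▸ (pow_dvd_pow _ hle).mul_left _⟩

lemma HasOrder.unique {p : Pt q} {h : CurveAlg q} {k k' : ℕ} (hk : HasOrder p h k)
    (hk' : HasOrder p h k') : k = k' :=
  le_antisymm (hk'.mem_vanishing_iff.1 (hk.mem_vanishing_iff.2 le_rfl))
    (hk.mem_vanishing_iff.1 (hk'.mem_vanishing_iff.2 le_rfl))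

/-- The order of vanishing at `p` of the polynomial `x - p.x`. -/
def ramification (p : Pt q) : ℕ := if p.1.2 = 0 then 2 else 1

lemma exists_cofactor {p : Pt q} (hv : p.1.2 = 0) :
    ∃ r : ℝ[X], q = (X - C p.1.1) * r ∧ r.eval p.1.1 ≠ 0 :=
  hq.simple_root _ (by simpa [hv] using p.2)

lemma hasOrder_X_sub_C (p : Pt q) :
    HasOrder p (algebraMap ℝ[X] (CurveAlg q) (X - C p.1.1)) (ramification p) := by
  unfold ramification
  split_ifs with hv
  · obtain ⟨r, hr, hr0⟩ := exists_cofactor hv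
    refine ⟨algebraMap ℝ[X] _ r, -1, by simpa using hr0, by simp, ?_⟩
    simp only [unif, if_pos hv]
    rw [omega_sq, ← map_mul, map_neg, neg_one_mul, neg_neg, mul_comm r, ← hr]
  · exact ⟨1, 1, by simp, by simp, by simp [unif, hv]⟩

lemma hasOrder_algebraMap (p : Pt q) {r : ℝ[X]} (hr : r ≠ 0) :
    HasOrder p (algebraMap ℝ[X] (CurveAlg q) r) (r.rootMultiplicity p.1.1 * ramification p) := by
  obtain ⟨g, hg, hd⟩ := exists_eq_pow_rootMultiplicity_mul_and_not_dvd r hr p.1.1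
  have h1 := ((hasOrder_X_sub_C p).pow (r.rootMultiplicity p.1.1)).mul
    (hasOrder_zero (p := p) (h := algebraMap ℝ[X] _ g) (by
      rw [dvd_iff_isRoot] at hd; simpa using hd))
  rwa [← map_pow, ← map_mul, ← hg] at h1

lemma hasOrder_one_of_eval_im_ne_zero {p : Pt q} (hv : p.1.2 = 0) {h : CurveAlg q}
    (hre : h.re.eval p.1.1 = 0) (him : h.im.eval p.1.1 ≠ 0) : HasOrder p h 1 := by
  obtain ⟨r, hr, hr0⟩ := exists_cofactor hv
  obtain ⟨a, ha⟩ := dvd_iff_isRoot.2 hre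
  refine ⟨algebraMap ℝ[X] _ r, ⟨h.im * r, -a⟩, by simpa using hr0, ?_, ?_⟩
  · simp [ev_apply, hv, him, hr0]
  · simp only [unif, if_pos hv, pow_one]
    ext1
    · simp only [re_mul, algebraMap_re, algebraMap_im, omega_re, omega_im, ha]
      linear_combination a * -hr
    · simp [algebraMap_re, algebraMap_im, omega_re, omega_im, mul_comm]

lemma exists_hasOrder (p : Pt q) {h : CurveAlg q} (hh : h ≠ 0) : ∃ k, HasOrder p h k := by
  induction hn : h.norm.natDegree using Nat.strong_induction_on generalizing h with
  | _ n ih =>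
  by_cases hdvd : algebraMap ℝ[X] (CurveAlg q) (X - C p.1.1) ∣ h
  · obtain ⟨g, rfl⟩ := hdvd
    have hg : g ≠ 0 := right_ne_zero_of_mul hh
    obtain ⟨k, hk⟩ := ih g.norm.natDegree (by
      rw [map_mul, norm_algebraMap_eq, natDegree_mul (pow_ne_zero _ (X_sub_C_ne_zero _))
        (norm_ne_zero hg), natDegree_pow, natDegree_X_sub_C] at hn
      omega) hg rfl
    exact ⟨_, (hasOrder_X_sub_C p).mul hk⟩
  · rw [algebraMap_X_sub_C_dvd] at hdvd
    by_cases hev : ev p h = 0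
    · by_cases hv : p.1.2 = 0
      · have hre : h.re.eval p.1.1 = 0 := by simpa [ev_apply, hv] using hev
        exact ⟨1, hasOrder_one_of_eval_im_ne_zero hv hre fun h0 => hdvd ⟨hre, h0⟩⟩
      · have hst : ev p (star h) ≠ 0 := by
          intro h0
          rw [ev_apply] at h0 hev
          simp only [re_star, im_star, zero_mul, add_zero, eval_neg] at h0
          have h1 : h.im.eval p.1.1 * p.1.2 = 0 := by linarith
          exact hdvd ⟨by linarith, (mul_eq_zero.1 h1).resolve_right hv⟩
        obtain ⟨s, r, hs, hr, e⟩ := hasOrder_algebraMap p (norm_ne_zero hh)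
        refine ⟨h.norm.rootMultiplicity p.1.1 * ramification p, s * star h, r,
          by simp [hs, hst], hr, ?_⟩
        rw [← e, algebraMap_norm_eq_mul_star]; ring
    · exact ⟨0, hasOrder_zero hev⟩

open Classical in
/-- The order of vanishing of `h` at `p` (and `0` for `h = 0`). -/
def ord (p : Pt q) (h : CurveAlg q) : ℕ :=
  if hh : h = 0 then 0 else (exists_hasOrder p hh).choose

lemma hasOrder_ord (p : Pt q) {h : CurveAlg q} (hh : h ≠ 0) : HasOrder p h (ord p h) := by
  rw [ord, dif_neg hh]; exact (exists_hasOrder p hh).choose_spec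

lemma HasOrder.ord_eq {p : Pt q} {h : CurveAlg q} {k : ℕ} (hk : HasOrder p h k) (hh : h ≠ 0) :
    ord p h = k :=
  (hasOrder_ord p hh).unique hk

lemma mem_vanishing_iff_le_ord {p : Pt q} {h : CurveAlg q} (hh : h ≠ 0) {e : ℕ} :
    h ∈ vanishing p e ↔ e ≤ ord p h :=
  (hasOrder_ord p hh).mem_vanishing_iff

lemma ord_mul (p : Pt q) {f g : CurveAlg q} (hf : f ≠ 0) (hg : g ≠ 0) :
    ord p (f * g) = ord p f + ord p g :=
  ((hasOrder_ord p hf).mul (hasOrder_ord p hg)).ord_eq (mul_ne_zero hf hg)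

lemma ord_sq (p : Pt q) {f : CurveAlg q} (hf : f ≠ 0) : ord p (f ^ 2) = 2 * ord p f := by
  rw [sq, ord_mul p hf hf, two_mul]

lemma ord_star (p : Pt q) {f : CurveAlg q} (hf : f ≠ 0) : ord p (star f) = ord (conj p) f := by
  have := (hasOrder_ord (conj p) hf).star
  rw [conj_conj] at this
  exact this.ord_eq (star_ne_zero.2 hf)

lemma ord_add_ord_conj (p : Pt q) {f : CurveAlg q} (hf : f ≠ 0) :
    ord p f + ord (conj p) f = f.norm.rootMultiplicity p.1.1 * ramification p := by
  rw [← ord_star p hf, ← ord_mul p hf (star_ne_zero.2 hf), ← algebraMap_norm_eq_mul_star]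
  refine (hasOrder_algebraMap p (norm_ne_zero hf)).ord_eq ?_
  rw [algebraMap_norm_eq_mul_star]
  exact mul_ne_zero hf (star_ne_zero.2 hf)

end Order

end CurveAlg

namespace CurveAlg

open QuadraticAlgebra

variable {q : ℝ[X]}

/-- The elements vanishing to order at least `e p` at every real point `p`. -/
def vanishingAt (e : Pt q → ℕ) : Submodule ℝ (CurveAlg q) := ⨅ p, vanishing p (e p)

lemma mem_vanishingAt {e : Pt q → ℕ} {h : CurveAlg q} :
    h ∈ vanishingAt e ↔ ∀ p, h ∈ vanishing p (e p) := by
  simp [vanishingAt, Submodule.mem_iInf]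

lemma exists_pt {c : ℝ} (hc : q.eval c ≤ 0) : ∃ p : Pt q, p.1.1 = c :=
  ⟨⟨(c, √(-q.eval c)), by simp [Real.sq_sqrt (neg_nonneg.2 hc)]⟩, rfl⟩

section Counting

variable [hq : SmoothQuartic q]

lemma le_ord_conj_pair_sum (p : Pt q) {f : CurveAlg q} (hf : f ≠ 0) :
    ∃ Z : Finset (Pt q), (∀ p' : Pt q, p'.1.1 = p.1.1 → p' ∈ Z) ∧
      ∑ p' ∈ Z, ord p' f = f.norm.rootMultiplicity p.1.1 := by
  classical
  have h := ord_add_ord_conj p hf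
  refine ⟨{p, conj p}, fun p' hp' => by simpa using eq_or_eq_conj hp', ?_⟩
  unfold ramification at h
  split_ifs at h with hv
  · rw [conj_eq_self hv] at h ⊢
    simp only [Finset.pair_eq_singleton, Finset.sum_singleton]
    omega
  · rw [Finset.sum_pair, h, mul_one]
    intro h'
    have := congrArg (fun p : Pt q => p.1.2) h'
    simp only [conj] at this
    exact hv (by linarith)

open Classical in
lemma sum_ord_le_sum_rootMultiplicity (Z : Finset (Pt q)) {f : CurveAlg q} (hf : f ≠ 0) :
    ∑ p ∈ Z, ord p f ≤ ∑ c ∈ Z.image (fun p => p.1.1), f.norm.rootMultiplicity c := by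
  rw [← Finset.sum_fiberwise_of_maps_to (g := fun p : Pt q => p.1.1)
    (fun p hp => Finset.mem_image_of_mem (fun p : Pt q => p.1.1) hp)]
  refine Finset.sum_le_sum fun c hc => ?_
  obtain ⟨p, -, rfl⟩ := Finset.mem_image.1 hc
  obtain ⟨Y, hY, hs⟩ := le_ord_conj_pair_sum p hf
  rw [← hs]
  exact Finset.sum_le_sum_of_subset fun p' hp' => hY p' (Finset.mem_filter.1 hp').2

lemma sum_rootMultiplicity_le (Y : Finset ℝ) (r : ℝ[X]) :
    ∑ c ∈ Y, r.rootMultiplicity c ≤ r.roots.card := by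
  classical
  simp_rw [← count_roots]
  rw [← Multiset.sum_count_eq_card (s := Y ∪ r.roots.toFinset) (m := r.roots) (by simp +contextual)]
  exact Finset.sum_le_sum_of_subset Finset.subset_union_left

lemma finite_ord_ne_zero {f : CurveAlg q} (hf : f ≠ 0) : {p : Pt q | ord p f ≠ 0}.Finite := by
  classical
  refine Set.Finite.subset (Set.Finite.preimage' (f := fun p : Pt q => p.1.1)
    (f.norm.roots.toFinset.finite_toSet) fun c _ => ?_) fun p hp => ?_
  · by_cases h : ∃ p : Pt q, p.1.1 = c
    · obtain ⟨p, rfl⟩ := h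
      exact (Set.toFinite {p, conj p}).subset fun p' hp' => by simpa using eq_or_eq_conj hp'
    · convert Set.finite_empty
      ext p
      simpa using fun hp => h ⟨p, hp⟩
  · have h := ord_add_ord_conj p hf
    have h0 : f.norm.rootMultiplicity p.1.1 ≠ 0 := by
      intro h0
      rw [h0, zero_mul] at h
      exact hp (by omega)
    simp only [Set.mem_preimage, Finset.mem_coe, Multiset.mem_toFinset]
    rw [← Multiset.count_pos, count_roots]
    exact Nat.pos_of_ne_zero h0

lemma exists_smul_add_mem_vanishing_succ (p : Pt q) {e : ℕ} {f g : CurveAlg q}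
    (hf : f ∈ vanishing p e) (hg : g ∈ vanishing p e) (hg' : g ∉ vanishing p (e + 1)) :
    ∃ c : ℝ, f + c • g ∈ vanishing p (e + 1) := by
  obtain ⟨s, hs, t, ht⟩ := hf
  have hg0 : g ≠ 0 := fun h => hg' (h ▸ zero_mem _)
  have ho : HasOrder p g e := by
    have := hasOrder_ord p hg0
    rw [mem_vanishing_iff_le_ord hg0] at hg hg'
    rwa [show ord p g = e by omega] at this
  obtain ⟨s', r, hs', hr, h⟩ := ho
  refine ⟨-(ev p (s' * t) / ev p (s * r)), ?_⟩
  set c := -(ev p (s' * t) / ev p (s * r)) with hc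
  set m := s' * t + c • (s * r) with hm
  have hm0 : ev p m = 0 := by
    have : ev p (s * r) ≠ 0 := by simp [hs, hr]
    simp only [hm, map_add, map_smul, smul_eq_mul, hc]
    field_simp
    ring
  have hm1 : m ∈ vanishing p 1 := by
    rcases eq_or_ne m 0 with h0 | h0
    · exact h0 ▸ zero_mem _
    · rw [mem_vanishing_iff_le_ord h0]
      by_contra hlt
      obtain ⟨s'', r'', hs'', hr'', h''⟩ := hasOrder_ord p h0
      rw [show ord p m = 0 by omega, pow_zero, mul_one] at h''
      have := congrArg (ev p) h''
      rw [map_mul, hm0, mul_zero] at this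
      exact hr'' this.symm
  obtain ⟨s'', hs'', t'', ht''⟩ := hm1
  refine ⟨s'' * (s * s'), by simp [hs, hs', hs''], t'', ?_⟩
  have : s * s' * (f + c • g) = m * unif p ^ e := by
    simp only [hm, Algebra.smul_def]
    linear_combination s' * ht + algebraMap ℝ (CurveAlg q) c * s * h
  rw [mul_assoc, this, ← mul_assoc, ht'', pow_one]; ring

lemma finrank_inf_vanishing_succ (p : Pt q) (e : ℕ) (U : Submodule ℝ (CurveAlg q))
    [FiniteDimensional ℝ U] :
    Module.finrank ℝ (U ⊓ vanishing p e : Submodule ℝ (CurveAlg q)) ≤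
      Module.finrank ℝ (U ⊓ vanishing p (e + 1) : Submodule ℝ (CurveAlg q)) + 1 := by
  by_cases h : U ⊓ vanishing p e ≤ vanishing p (e + 1)
  · exact (Submodule.finrank_mono (le_inf inf_le_left h)).trans (Nat.le_succ _)
  · obtain ⟨g, ⟨hgU, hg⟩, hg'⟩ := SetLike.not_le_iff_exists.1 h
    have hle : U ⊓ vanishing p e ≤ (U ⊓ vanishing p (e + 1)) ⊔ Submodule.span ℝ {g} := by
      rintro f ⟨hfU, hf⟩
      obtain ⟨c, hc⟩ := exists_smul_add_mem_vanishing_succ p hf hg hg'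
      refine Submodule.mem_sup.2 ⟨f + c • g, ⟨add_mem hfU (U.smul_mem c hgU), hc⟩,
        -(c • g), neg_mem (Submodule.smul_mem _ _ (Submodule.mem_span_singleton_self g)), by simp⟩
    refine (Submodule.finrank_mono hle).trans
      ((Submodule.finrank_add_le_finrank_add_finrank _ _).trans
      (Nat.add_le_add_left (finrank_span_le_card _ |>.trans (by simp)) _))

lemma finrank_le_inf_vanishing (p : Pt q) (e : ℕ) (U : Submodule ℝ (CurveAlg q))
    [FiniteDimensional ℝ U] :
    Module.finrank ℝ U ≤ Module.finrank ℝ (U ⊓ vanishing p e : Submodule ℝ (CurveAlg q)) + e := by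
  induction e with
  | zero => rw [vanishing_zero, inf_top_eq, add_zero]
  | succ e ih => have := finrank_inf_vanishing_succ p e U; omega

lemma finrank_le_inf_vanishingAt (U : Submodule ℝ (CurveAlg q)) [FiniteDimensional ℝ U]
    (e : Pt q → ℕ) (Z : Finset (Pt q)) (hZ : ∀ p ∉ Z, e p = 0) :
    Module.finrank ℝ U ≤
      Module.finrank ℝ (U ⊓ vanishingAt e : Submodule ℝ (CurveAlg q)) + ∑ p ∈ Z, e p := by
  classical
  suffices H : ∀ Y : Finset (Pt q), Module.finrank ℝ U ≤
      Module.finrank ℝ (U ⊓ ⨅ p ∈ Y, vanishing p (e p) : Submodule ℝ (CurveAlg q)) +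
        ∑ p ∈ Y, e p by
    have h1 : (⨅ p ∈ Z, vanishing p (e p)) = vanishingAt e := by
      refine le_antisymm (le_iInf fun p => ?_) (le_iInf₂ fun p _ => iInf_le _ p)
      by_cases hp : p ∈ Z
      · exact iInf₂_le p hp
      · rw [hZ p hp, vanishing_zero]; exact le_top
    rw [← h1]
    exact H Z
  intro Y
  induction Y using Finset.induction_on with
  | empty =>
    rw [show (⨅ p ∈ (∅ : Finset (Pt q)), vanishing p (e p)) = ⊤ by simp, inf_top_eq]
    simp
  | insert p Y hp ih =>
    rw [Finset.sum_insert hp, Finset.iInf_insert]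
    have := finrank_le_inf_vanishing p (e p) (U ⊓ ⨅ p ∈ Y, vanishing p (e p))
    rw [inf_assoc, inf_comm (⨅ p ∈ Y, vanishing p (e p))] at this
    omega

end Counting

section Divisibility

variable [hq : SmoothQuartic q]

lemma ev_eq_zero_of_mem_vanishing {p : Pt q} {e : ℕ} (he : 1 ≤ e) {f : CurveAlg q}
    (hf : f ∈ vanishing p e) : ev p f = 0 := by
  by_contra h
  have := (hasOrder_zero h).mem_vanishing_iff.1 hf
  omega

lemma X_sub_C_dvd_of_mem_vanishing {c : ℝ} (hc : q.eval c ≤ 0) {f : CurveAlg q}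
    (hf : ∀ p : Pt q, p.1.1 = c → f ∈ vanishing p (ramification p)) :
    algebraMap ℝ[X] (CurveAlg q) (X - C c) ∣ f := by
  obtain ⟨p, rfl⟩ := exists_pt hc
  have hr : ∀ p : Pt q, 1 ≤ ramification p := fun p => by unfold ramification; split_ifs <;> simp
  have h1 := ev_eq_zero_of_mem_vanishing (hr _) (hf p rfl)
  have h2 := ev_eq_zero_of_mem_vanishing (hr _) (hf (conj p) rfl)
  rw [algebraMap_X_sub_C_dvd]
  rw [ev_apply] at h1 h2
  simp only [conj] at h2
  have h3 : f.re.eval p.1.1 = 0 := by linarith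
  refine ⟨h3, ?_⟩
  by_cases hv : p.1.2 = 0
  · by_contra h4
    have h5 := (hasOrder_one_of_eval_im_ne_zero hv h3 h4).mem_vanishing_iff.1 (hf p rfl)
    simp [ramification, hv] at h5
  · have : f.im.eval p.1.1 * p.1.2 = 0 := by linarith
    exact (mul_eq_zero.1 this).resolve_right hv

lemma mem_vanishing_of_mul_mem {p : Pt q} {f g : CurveAlg q} {a b : ℕ} (hf : HasOrder p f a)
    (hfg : f * g ∈ vanishing p (a + b)) : g ∈ vanishing p b := by
  obtain ⟨s, r, hs, hr, e⟩ := hf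
  obtain ⟨s', hs', t, ht⟩ := hfg
  refine ⟨s' * r, by simp [hs', hr], s * t, ?_⟩
  refine mul_left_cancel₀ (pow_ne_zero a (unif_ne_zero p)) ?_
  linear_combination s * ht - s' * g * e

lemma prod_X_sub_C_dvd_of_mem_vanishing (m : Multiset ℝ) (hm : ∀ c ∈ m, q.eval c ≤ 0)
    {f : CurveAlg q}
    (hf : ∀ p : Pt q, f ∈ vanishing p (m.count p.1.1 * ramification p)) :
    algebraMap ℝ[X] (CurveAlg q) (m.map fun c => X - C c).prod ∣ f := by
  induction m using Multiset.induction_on generalizing f with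
  | empty => simp
  | cons c m ih =>
    obtain ⟨g, rfl⟩ := X_sub_C_dvd_of_mem_vanishing (hm c (Multiset.mem_cons_self c m)) (f := f) (by
      rintro p rfl
      obtain ⟨s, hs, hd⟩ := hf p
      refine ⟨s, hs, (pow_dvd_pow _ ?_).trans hd⟩
      rw [Multiset.count_cons_self]
      exact Nat.le_mul_of_pos_left _ (Nat.succ_pos _))
    rw [Multiset.map_cons, Multiset.prod_cons, map_mul]
    refine mul_dvd_mul_left _ (ih (fun c hc => hm c (Multiset.mem_cons_of_mem hc)) fun p => ?_)
    by_cases hp : p.1.1 = c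
    · subst hp
      refine mem_vanishing_of_mul_mem (hasOrder_X_sub_C p) ?_
      have := hf p
      rwa [Multiset.count_cons_self, Nat.succ_mul, add_comm] at this
    · refine mem_vanishing_of_mul_mem (a := 0) (hasOrder_zero
        (h := algebraMap ℝ[X] (CurveAlg q) (X - C c)) (by simpa [sub_eq_zero] using hp)) ?_
      have := hf p
      rwa [Multiset.count_cons_of_ne hp, ← zero_add (_ * _)] at this

/-- All zeros of `f` on the affine curve are real points. -/
def RealZeros (f : CurveAlg q) : Prop :=
  f.norm.Splits ∧ ∀ c ∈ f.norm.roots, q.eval c ≤ 0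

lemma RealZeros.dvd_sq {f h : CurveAlg q} (hf0 : f ≠ 0) (hf : RealZeros f)
    (h2 : ∀ p, h ^ 2 ∈ vanishing p (ord p f)) : f ∣ h ^ 2 := by
  rcases eq_or_ne h 0 with rfl | hh
  · simp
  have hs : star f ≠ 0 := star_ne_zero.2 hf0
  have key := prod_X_sub_C_dvd_of_mem_vanishing f.norm.roots hf.2 (f := h ^ 2 * star f) fun p => by
    have := h2 p
    rw [mem_vanishing_iff_le_ord (pow_ne_zero 2 hh)] at this
    rw [count_roots, ← ord_add_ord_conj p hf0,
      mem_vanishing_iff_le_ord (mul_ne_zero (pow_ne_zero 2 hh) hs),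
      ord_mul p (pow_ne_zero 2 hh) hs, ord_star p hf0]
    omega
  have h3 : algebraMap ℝ[X] (CurveAlg q) f.norm ∣ h ^ 2 * star f := by
    rw [hf.1.eq_prod_roots, map_mul]
    refine (IsUnit.mul_left_dvd ?_).2 key
    exact (isUnit_C.2 (isUnit_iff_ne_zero.2
      (leadingCoeff_ne_zero.2 (norm_ne_zero hf0)))).map (algebraMap ℝ[X] (CurveAlg q))
  rw [algebraMap_norm_eq_mul_star] at h3
  exact (mul_dvd_mul_iff_right hs).1 h3

lemma realZeros_of_natDegree_le_sum_ord {f : CurveAlg q} (hf : f ≠ 0) (Z : Finset (Pt q))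
    (h : f.norm.natDegree ≤ ∑ p ∈ Z, ord p f) : RealZeros f := by
  classical
  have h1 := sum_ord_le_sum_rootMultiplicity Z hf
  have h2 := sum_rootMultiplicity_le (Z.image (fun p => p.1.1)) f.norm
  have h3 := card_roots' f.norm
  refine ⟨splits_iff_card_roots.2 (by omega), fun c hc => ?_⟩
  by_contra hneg
  have hc' : c ∉ Z.image (fun p => p.1.1) := by
    intro hmem
    obtain ⟨p, -, rfl⟩ := Finset.mem_image.1 hmem
    nlinarith [p.2, sq_nonneg p.1.2]
  have h4 := sum_rootMultiplicity_le (insert c (Z.image (fun p => p.1.1))) f.norm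
  rw [Finset.sum_insert hc'] at h4
  have h5 : 0 < f.norm.rootMultiplicity c := by
    rw [← count_roots]; exact Multiset.count_pos.2 hc
  omega

end Divisibility

end CurveAlg

namespace CurveAlg

open QuadraticAlgebra Filter Topology

variable {q : ℝ[X]}

lemma continuous_ev (f : CurveAlg q) : Continuous fun p : Pt q => ev p f := by
  simp only [ev_apply]
  fun_prop

lemma frequently_of_branch {p : Pt q} {l : Filter ℝ} [l.NeBot] (hl : l ≤ 𝓝 p.1.1) {s : ℝ}
    (hs : s ^ 2 = 1) (hp : p.1.2 = s * √(-q.eval p.1.1)) (hneg : ∀ᶠ t in l, q.eval t < 0)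
    {P : Pt q → Prop}
    (hP : ∀ᶠ t in l, ∀ p' : Pt q, p'.1 = (t, s * √(-q.eval t)) → P p') :
    ∃ᶠ p' in 𝓝 p, P p' := by
  rw [nhds_subtype_eq_comap, frequently_comap]
  have hγ : Continuous fun t : ℝ => (t, s * √(-q.eval t)) := by fun_prop
  have ht : Tendsto (fun t : ℝ => (t, s * √(-q.eval t))) l (𝓝 p.1) := by
    have := (hγ.tendsto p.1.1).mono_left hl
    rwa [← hp] at this
  refine ht.frequently (Eventually.frequently ?_)
  filter_upwards [hneg, hP] with t h1 h2
  refine ⟨⟨(t, s * √(-q.eval t)), ?_⟩, rfl, h2 _ rfl⟩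
  simp only
  rw [mul_pow, hs, Real.sq_sqrt (by linarith)]; ring

lemma eventually_eval_neg {c : ℝ} (h : q.eval c < 0) : ∀ᶠ t in 𝓝 c, q.eval t < 0 :=
  q.continuous.continuousAt.eventually_lt continuousAt_const h

section

variable [hq : SmoothQuartic q]

lemma exists_filter_eval_neg {c : ℝ} (h : q.eval c = 0) :
    ∃ l : Filter ℝ, l.NeBot ∧ l ≤ 𝓝 c ∧ ∀ᶠ t in l, q.eval t < 0 := by
  obtain ⟨r, hr, hr0⟩ := hq.simple_root c h
  rcases lt_or_gt_of_ne hr0 with h0 | h0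
  · refine ⟨𝓝[>] c, inferInstance, nhdsWithin_le_nhds, ?_⟩
    filter_upwards [nhdsWithin_le_nhds (eventually_eval_neg h0), self_mem_nhdsWithin] with t h1 h2
    rw [hr]
    simpa using mul_neg_of_pos_of_neg (sub_pos.2 h2) h1
  · refine ⟨𝓝[<] c, inferInstance, nhdsWithin_le_nhds, ?_⟩
    filter_upwards [nhdsWithin_le_nhds
      (continuousAt_const.eventually_lt r.continuous.continuousAt h0), self_mem_nhdsWithin]
      with t h1 h2
    rw [hr]
    simpa using mul_neg_of_neg_of_pos (sub_neg.2 h2) h1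

lemma frequently_unif_sign (p : Pt q) {σ : ℝ} (hσ : σ ^ 2 = 1) :
    ∃ᶠ p' in 𝓝 p, 0 < σ * ev p' (unif p) := by
  by_cases hv : p.1.2 = 0
  · have h0 : q.eval p.1.1 = 0 := by simpa [hv] using p.2
    obtain ⟨l, hl, hle, hneg⟩ := exists_filter_eval_neg h0
    refine frequently_of_branch hle hσ (by simp [hv, h0]) hneg ?_
    filter_upwards [hneg] with t ht p' hp'
    simp only [unif, if_pos hv, ev_omega, hp']
    rw [← mul_assoc, ← sq, hσ, one_mul]
    exact Real.sqrt_pos.2 (by linarith)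
  · have hpos : 0 < p.1.2 ^ 2 := by positivity
    have hneg : q.eval p.1.1 < 0 := by linarith [p.2]
    have hs : (p.1.2 / |p.1.2|) ^ 2 = 1 := by
      rw [div_pow, sq_abs, div_self hpos.ne']
    have hp : p.1.2 = p.1.2 / |p.1.2| * √(-q.eval p.1.1) := by
      rw [show -q.eval p.1.1 = p.1.2 ^ 2 by linarith [p.2], Real.sqrt_sq_eq_abs]
      field_simp
    rcases sq_eq_sq_iff_eq_or_eq_neg.1 (hσ.trans (one_pow 2).symm) with rfl | rfl
    · refine frequently_of_branch (l := 𝓝[>] p.1.1) nhdsWithin_le_nhds hs hp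
        (nhdsWithin_le_nhds (eventually_eval_neg hneg)) ?_
      filter_upwards [self_mem_nhdsWithin] with t ht p' hp'
      simpa [unif, hv, hp'] using ht
    · refine frequently_of_branch (l := 𝓝[<] p.1.1) nhdsWithin_le_nhds hs hp
        (nhdsWithin_le_nhds (eventually_eval_neg hneg)) ?_
      filter_upwards [self_mem_nhdsWithin] with t ht p' hp'
      simpa [unif, hv, hp'] using ht

lemma frequently_ev_ne_zero (p : Pt q) {f : CurveAlg q} (hf : f ≠ 0) :
    ∃ᶠ p' in 𝓝 p, ev p' f ≠ 0 := by
  obtain ⟨s, r, hs, hr, e⟩ := hasOrder_ord p hf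
  refine ((frequently_unif_sign p (one_pow 2)).and_eventually
    ((continuous_ev r).continuousAt.eventually_ne hr)).mono ?_
  rintro p' ⟨h1, h2⟩ h3
  have := congrArg (ev p') e
  rw [map_mul, h3, mul_zero, map_mul, map_pow] at this
  rw [one_mul] at h1
  exact mul_ne_zero h2 (pow_ne_zero _ h1.ne') this.symm

lemma nonempty_pt : Nonempty (Pt q) := by
  obtain ⟨x, hx⟩ := hq.exists_neg
  exact ⟨(exists_pt hx.le).choose⟩

lemma eq_zero_of_ev_eq_zero {f : CurveAlg q} (hf : ∀ p, ev p f = 0) : f = 0 := by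
  by_contra h
  obtain ⟨p⟩ := nonempty_pt (q := q)
  obtain ⟨p', hp'⟩ := (frequently_ev_ne_zero p h).exists
  exact hp' (hf p')

lemma even_ord_of_nonneg (p : Pt q) {f : CurveAlg q} (hf : f ≠ 0) (hpos : ∀ p, 0 ≤ ev p f) :
    Even (ord p f) := by
  rw [← Nat.not_odd_iff_even]
  intro hodd
  obtain ⟨s, r, hs, hr, e⟩ := hasOrder_ord p hf
  have hsr : ev p (s * r) ≠ 0 := by simp [hs, hr]
  obtain ⟨σ, hσ, hpos'⟩ : ∃ σ : ℝ, σ ^ 2 = 1 ∧ σ * ev p (s * r) < 0 := by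
    rcases lt_or_gt_of_ne hsr with h | h
    · exact ⟨1, by norm_num, by linarith⟩
    · exact ⟨-1, by norm_num, by linarith⟩
  obtain ⟨p', h1, h2⟩ := ((frequently_unif_sign p hσ).and_eventually
    (((continuous_ev (s * r)).const_mul σ).continuousAt.eventually_lt
      continuousAt_const hpos')).exists
  have h3 := congrArg (ev p') e
  have h4 : ev p' s ^ 2 * ev p' f = (σ * ev p' (s * r)) * (σ * ev p' (unif p)) ^ ord p f := by
    rw [mul_pow, show σ ^ ord p f = σ by
      obtain ⟨k, hk⟩ := hodd
      rw [hk, pow_succ, pow_mul, hσ, one_pow, one_mul]]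
    simp only [map_mul, map_pow] at h3 ⊢
    linear_combination ev p' s * h3 -
      (ev p' s * ev p' r * ev p' (unif p) ^ ord p f) * hσ
  have h5 : 0 ≤ ev p' s ^ 2 * ev p' f := mul_nonneg (sq_nonneg _) (hpos p')
  have h6 := mul_neg_of_neg_of_pos h2 (pow_pos h1 (ord p f))
  linarith

lemma tendsto_eval_atTop : Tendsto (fun x => q.eval x) atTop atTop :=
  q.tendsto_atTop_of_leadingCoeff_nonneg
    (by rw [degree_eq_natDegree hq.monic.ne_zero, hq.natDegree_eq]; norm_num)
    (by rw [hq.monic.leadingCoeff]; norm_num)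

lemma tendsto_eval_neg_atTop : Tendsto (fun x => q.eval (-x)) atTop atTop := by
  have h : (q.comp (-X)).natDegree = 4 := by simp [natDegree_comp, hq.natDegree_eq]
  have := (q.comp (-X)).tendsto_atTop_of_leadingCoeff_nonneg
    (by rw [degree_eq_natDegree (fun h0 => by simp [h0] at h), h]; norm_num)
    (by rw [leadingCoeff_comp (by simp), hq.monic.leadingCoeff, hq.natDegree_eq]; norm_num)
  simpa using this

instance : CompactSpace (Pt q) := by
  obtain ⟨A, hA⟩ := (tendsto_atTop.1 (tendsto_eval_atTop (q := q)) 1).exists_forall_of_atTop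
  obtain ⟨B, hB⟩ := (tendsto_atTop.1 (tendsto_eval_neg_atTop (q := q)) 1).exists_forall_of_atTop
  obtain ⟨m, hm⟩ := (isCompact_Icc (a := -B) (b := A)).bddBelow_image q.continuous.continuousOn
  suffices IsCompact {p : ℝ × ℝ | p.2 ^ 2 + q.eval p.1 = 0} from isCompact_iff_compactSpace.1 this
  refine ((isCompact_Icc (a := -B) (b := A)).prod (isCompact_Icc (a := -(-m + 1))
    (b := (-m + 1)))).of_isClosed_subset (isClosed_eq (by fun_prop) continuous_const) ?_
  rintro ⟨u, v⟩ h
  simp only [Set.mem_ofPred_eq] at h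
  have hu : u ∈ Set.Icc (-B) A := by
    constructor
    · by_contra hlt
      have := hB (-u) (by linarith)
      rw [neg_neg] at this
      nlinarith [sq_nonneg v]
    · by_contra hlt
      have := hA u (by linarith)
      nlinarith [sq_nonneg v]
  have := hm (Set.mem_image_of_mem _ hu)
  exact ⟨hu, abs_le.1 (by nlinarith [sq_abs v, abs_nonneg v, sq_nonneg (|v| - 1)])⟩

lemma exists_bound_of_vanishing {f g : CurveAlg q} (hf : f ≠ 0) (hpos : ∀ p, 0 ≤ ev p f)
    (hg : ∀ p, g ∈ vanishing p (ord p f)) : ∃ K : ℝ, ∀ p, |ev p g| ≤ K * ev p f := by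
  have hloc : ∀ p : Pt q, ∃ K : ℝ, ∀ᶠ p' in 𝓝 p, |ev p' g| ≤ K * ev p' f := by
    intro p
    obtain ⟨s, r, hs, hr, e⟩ := hasOrder_ord p hf
    obtain ⟨s', hs', t, ht⟩ := hg p
    have h1 : s' * r * g = s * t * f := by
      linear_combination r * ht - t * e
    have h0 : ev p (s' * r) ≠ 0 := by simp [hs', hr]
    have hc : ContinuousAt (fun p' => |ev p' (s * t) / ev p' (s' * r)|) p :=
      ((continuous_ev _).continuousAt.div (continuous_ev _).continuousAt h0).abs
    refine ⟨|ev p (s * t) / ev p (s' * r)| + 1, ?_⟩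
    filter_upwards [hc.eventually_lt continuousAt_const (lt_add_one _),
      (continuous_ev (s' * r)).continuousAt.eventually_ne h0] with p' h2 h3
    have h4 : ev p' g = ev p' (s * t) / ev p' (s' * r) * ev p' f := by
      rw [div_mul_eq_mul_div, eq_div_iff h3, mul_comm, ← map_mul, ← map_mul, h1]
    rw [h4, abs_mul, abs_of_nonneg (hpos p')]
    exact mul_le_mul_of_nonneg_right h2.le (hpos p')
  choose K hK using hloc
  obtain ⟨Z, -, hZ⟩ := isCompact_univ.elim_nhds_subcover _ fun p _ => hK p
  refine ⟨∑ p ∈ Z, |K p|, fun p' => ?_⟩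
  obtain ⟨p, hp, hp'⟩ := Set.mem_iUnion₂.1 (hZ (Set.mem_univ p'))
  refine le_trans (show |ev p' g| ≤ K p * ev p' f from hp')
    (mul_le_mul_of_nonneg_right ?_ (hpos p'))
  exact (le_abs_self _).trans (Finset.single_le_sum (f := fun p => |K p|)
    (fun _ _ => abs_nonneg _) hp)

end

end CurveAlg

section ExtremalDecomposition

/-- The functions in `E` dominated by a multiple of `f`, for a family `φ` of linear functionals
viewed as points. -/
def dominated {E P : Type*} [AddCommGroup E] [Module ℝ E] (φ : P → E →ₗ[ℝ] ℝ) {f : E}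
    (_hf : ∀ p, 0 ≤ φ p f) : Submodule ℝ E where
  carrier := {g | ∃ K : ℝ, ∀ p, |φ p g| ≤ K * φ p f}
  zero_mem' := ⟨0, by simp⟩
  add_mem' := by
    rintro a b ⟨K, hK⟩ ⟨K', hK'⟩
    refine ⟨K + K', fun p => ?_⟩
    rw [map_add, add_mul]
    exact (abs_add_le _ _).trans (add_le_add (hK p) (hK' p))
  smul_mem' := by
    rintro c a ⟨K, hK⟩
    refine ⟨|c| * K, fun p => ?_⟩
    rw [map_smul, smul_eq_mul, abs_mul, mul_assoc]
    exact mul_le_mul_of_nonneg_left (hK p) (abs_nonneg c)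

variable {E P : Type*} [AddCommGroup E] [Module ℝ E] {φ : P → E →ₗ[ℝ] ℝ}

lemma self_mem_dominated {f : E} (hf : ∀ p, 0 ≤ φ p f) : f ∈ dominated φ hf :=
  ⟨1, fun p => by rw [abs_of_nonneg (hf p), one_mul]⟩

lemma exists_add_smul_boundary {f g : E} (hf : ∀ p, 0 ≤ φ p f) (hg : g ∈ dominated φ hf)
    {p₀ : P} (hp₀ : φ p₀ g < 0) :
    ∃ t : ℝ, 0 < t ∧ ∃ h : ∀ p, 0 ≤ φ p (f + t • g),
      dominated φ h < dominated φ hf := by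
  obtain ⟨K, hK⟩ := hg
  have hK1 : 0 < |K| + 1 := by positivity
  have hK' : ∀ p, |φ p g| ≤ (|K| + 1) * φ p f := fun p =>
    (hK p).trans (mul_le_mul_of_nonneg_right ((le_abs_self K).trans (by linarith)) (hf p))
  set T : Set ℝ := {t | ∀ p, 0 ≤ φ p (f + t • g)} with hT
  have hT0 : (|K| + 1)⁻¹ ∈ T := by
    intro p
    rw [map_add, map_smul, smul_eq_mul]
    have h1 := (abs_le.1 (hK' p)).1
    have h2 : (|K| + 1)⁻¹ * -((|K| + 1) * φ p f) ≤ (|K| + 1)⁻¹ * φ p g :=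
      mul_le_mul_of_nonneg_left h1 (by positivity)
    rw [mul_neg, ← mul_assoc, inv_mul_cancel₀ hK1.ne', one_mul] at h2
    linarith
  have hbdd : BddAbove T := by
    refine ⟨φ p₀ f / -φ p₀ g, fun t ht => ?_⟩
    have := ht p₀
    rw [map_add, map_smul, smul_eq_mul] at this
    rw [le_div_iff₀ (by linarith)]
    linarith
  have hclosed : IsClosed T := by
    rw [hT, Set.ofPred_forall]
    refine isClosed_iInter fun p => isClosed_le continuous_const ?_
    simp only [map_add, map_smul, smul_eq_mul]
    fun_prop
  have hmem : sSup T ∈ T := hclosed.csSup_mem ⟨_, hT0⟩ hbdd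
  have hpos : 0 < sSup T := (inv_pos.2 hK1).trans_le (le_csSup hbdd hT0)
  refine ⟨sSup T, hpos, hmem, lt_of_le_of_ne ?_ fun heq => ?_⟩
  · rintro k ⟨K₁, hK₁⟩
    refine ⟨|K₁| * (1 + sSup T * (|K| + 1)), fun p => (hK₁ p).trans ?_⟩
    have h1 : φ p (f + sSup T • g) ≤ (1 + sSup T * (|K| + 1)) * φ p f := by
      rw [map_add, map_smul, smul_eq_mul]
      have := mul_le_mul_of_nonneg_left ((le_abs_self _).trans (hK' p)) hpos.le
      linarith
    calc K₁ * φ p (f + sSup T • g) ≤ |K₁| * φ p (f + sSup T • g) :=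
          mul_le_mul_of_nonneg_right (le_abs_self _) (hmem p)
      _ ≤ |K₁| * ((1 + sSup T * (|K| + 1)) * φ p f) :=
          mul_le_mul_of_nonneg_left h1 (abs_nonneg _)
      _ = _ := by ring
  · have hg : g ∈ dominated φ hmem := heq ▸ ⟨K, hK⟩
    obtain ⟨K₂, hK₂⟩ := hg
    have h2 : sSup T + (|K₂| + 1)⁻¹ ∈ T := by
      intro p
      have hp : 0 < |K₂| + 1 := by positivity
      have h1 : |φ p g| ≤ (|K₂| + 1) * φ p (f + sSup T • g) := (hK₂ p).trans
        (mul_le_mul_of_nonneg_right ((le_abs_self K₂).trans (by linarith)) (hmem p))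
      have h3 := mul_le_mul_of_nonneg_left (abs_le.1 h1).1 (inv_pos.2 hp).le
      rw [mul_neg, ← mul_assoc, inv_mul_cancel₀ hp.ne', one_mul] at h3
      rw [add_smul, ← add_assoc, map_add, map_smul _ (_)⁻¹, smul_eq_mul]
      linarith
    have h3 := le_csSup hbdd h2
    have : 0 < (|K₂| + 1)⁻¹ := by positivity
    linarith

/-- In finite dimension, every nonnegative element is a sum of extremal nonnegative elements. -/
lemma induction_on_extremal [FiniteDimensional ℝ E] (hφ : ∀ f, (∀ p, φ p f = 0) → f = 0)
    {Q : E → Prop} (hzero : Q 0) (hadd : ∀ f g, Q f → Q g → Q (f + g))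
    (hsmul : ∀ (t : ℝ) f, 0 ≤ t → Q f → Q (t • f))
    (hext : ∀ f, f ≠ 0 → ∀ hf : ∀ p, 0 ≤ φ p f, dominated φ hf ≤ Submodule.span ℝ {f} → Q f)
    (f : E) (hf : ∀ p, 0 ≤ φ p f) : Q f := by
  induction hn : Module.finrank ℝ (dominated φ hf) using Nat.strong_induction_on
    generalizing f with
  | _ n ih =>
  rcases eq_or_ne f 0 with rfl | hf0
  · exact hzero
  by_cases hle : dominated φ hf ≤ Submodule.span ℝ {f}
  · exact hext f hf0 hf hle
  obtain ⟨g, hg, hgf⟩ := SetLike.not_le_iff_exists.1 hle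
  have hlt : ∀ k ∈ dominated φ hf, (∃ p, φ p k < 0) → ∃ t : ℝ, 0 < t ∧ Q (f + t • k) := by
    rintro k hk ⟨p₀, hp₀⟩
    obtain ⟨t, ht, h, hlt⟩ := exists_add_smul_boundary hf hk hp₀
    exact ⟨t, ht, ih _ (hn ▸ Submodule.finrank_lt_finrank_of_lt hlt) _ h rfl⟩
  obtain ⟨p₁, hp₁⟩ : ∃ p, φ p f ≠ 0 := by
    by_contra! h
    exact hf0 (hφ f h)
  have hp₁' : 0 < φ p₁ f := lt_of_le_of_ne (hf p₁) hp₁.symm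
  obtain ⟨p₂, hp₂⟩ : ∃ p, φ p (g - (φ p₁ g / φ p₁ f) • f) ≠ 0 := by
    by_contra! h
    have := sub_eq_zero.1 (hφ _ h)
    exact hgf (this ▸ Submodule.smul_mem _ _ (Submodule.mem_span_singleton_self f))
  have hp₂' : 0 < φ p₂ f := by
    refine lt_of_le_of_ne (hf p₂) fun h0 => hp₂ ?_
    obtain ⟨K, hK⟩ := hg
    have := hK p₂
    rw [← h0, mul_zero] at this
    rw [map_sub, map_smul, ← h0, abs_nonpos_iff.1 this]; simp
  rw [map_sub, map_smul, smul_eq_mul] at hp₂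
  set s₁ := φ p₁ g / φ p₁ f with hs₁
  set s₂ := φ p₂ g / φ p₂ f with hs₂
  have e₁ : φ p₁ g = s₁ * φ p₁ f := by rw [hs₁]; field_simp
  have e₂ : φ p₂ g = s₂ * φ p₂ f := by rw [hs₂]; field_simp
  have hne : s₁ ≠ s₂ := by
    intro h
    rw [e₂, h, sub_self] at hp₂
    exact hp₂ rfl
  set k := g - ((s₁ + s₂) / 2) • f with hk
  have hkm : k ∈ dominated φ hf :=
    sub_mem hg (Submodule.smul_mem _ _ (self_mem_dominated hf))
  have k₁ : φ p₁ k = (s₁ - s₂) / 2 * φ p₁ f := by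
    rw [hk, map_sub, map_smul, smul_eq_mul, e₁]; ring
  have k₂ : φ p₂ k = (s₂ - s₁) / 2 * φ p₂ f := by
    rw [hk, map_sub, map_smul, smul_eq_mul, e₂]; ring
  have hsign : (∃ p, φ p k < 0) ∧ ∃ p, φ p (-k) < 0 := by
    simp only [map_neg, neg_lt_zero]
    rcases lt_or_gt_of_ne hne with h | h
    · exact ⟨⟨p₁, k₁ ▸ mul_neg_of_neg_of_pos (by linarith) hp₁'⟩,
        ⟨p₂, k₂ ▸ mul_pos (by linarith) hp₂'⟩⟩
    · exact ⟨⟨p₂, k₂ ▸ mul_neg_of_neg_of_pos (by linarith) hp₂'⟩,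
        ⟨p₁, k₁ ▸ mul_pos (by linarith) hp₁'⟩⟩
  obtain ⟨t₁, ht₁, h₁⟩ := hlt k hkm hsign.1
  obtain ⟨t₂, ht₂, h₂⟩ := hlt (-k) (neg_mem hkm) hsign.2
  have hsum : f = (t₂ / (t₁ + t₂)) • (f + t₁ • k) + (t₁ / (t₁ + t₂)) • (f + t₂ • -k) := by
    have : t₁ + t₂ ≠ 0 := by positivity
    match_scalars <;> field_simp <;> ring
  rw [hsum]
  exact hadd _ _ (hsmul _ _ (by positivity) h₁) (hsmul _ _ (by positivity) h₂)

end ExtremalDecomposition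

namespace CurveAlg

open QuadraticAlgebra Filter Topology

variable {q : ℝ[X]}

/-- Evaluation at a point, on functions of bounded degree. -/
def evLE (d : ℕ) (p : Pt q) : degreeLE q d →ₗ[ℝ] ℝ := (ev p).toLinearMap ∘ₗ (degreeLE q d).subtype

@[simp] lemma evLE_apply (d : ℕ) (p : Pt q) (f : degreeLE q d) : evLE d p f = ev p f.1 := rfl

variable [hq : SmoothQuartic q]

lemma even_natDegree_norm (f : CurveAlg q) : Even f.norm.natDegree := by
  rcases eq_or_ne f 0 with rfl | hf
  · simp [QuadraticAlgebra.norm_zero]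
  have h := degree_norm hf
  rw [degree_eq_natDegree (norm_ne_zero hf)] at h
  rcases max_choice (2 * f.re.degree) (4 + 2 * f.im.degree) with h1 | h1 <;> rw [h1] at h
  · have h0 : f.re ≠ 0 := by rintro h0; simp [h0] at h
    rw [degree_eq_natDegree h0] at h
    exact ⟨f.re.natDegree, by rw [← two_mul]; exact_mod_cast h⟩
  · have h0 : f.im ≠ 0 := by rintro h0; simp [h0] at h
    rw [degree_eq_natDegree h0] at h
    have : f.norm.natDegree = 4 + 2 * f.im.natDegree := by exact_mod_cast h
    exact ⟨2 + f.im.natDegree, by omega⟩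

lemma nonneg_of_nonneg_mul {f g : CurveAlg q} (hf : f ≠ 0) (hpos : ∀ p, 0 ≤ ev p f)
    (hfg : ∀ p, 0 ≤ ev p (f * g)) (p : Pt q) : 0 ≤ ev p g := by
  by_contra! h
  obtain ⟨p', h1, h2⟩ := ((frequently_ev_ne_zero p hf).and_eventually
    ((continuous_ev g).continuousAt.eventually_lt continuousAt_const h)).exists
  have := hfg p'
  rw [map_mul] at this
  exact absurd this (not_le.2 (mul_neg_of_pos_of_neg (lt_of_le_of_ne (hpos p') h1.symm) h2))

/-- An extremal nonnegative function has as many real zeros as its degree allows. -/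
lemma realZeros_of_extremal {d : ℕ} (hd : Odd d) {f : degreeLE q d} (hf0 : f ≠ 0)
    {hf : ∀ p, 0 ≤ evLE d p f} (hle : dominated (evLE d) hf ≤ Submodule.span ℝ {f}) :
    RealZeros f.1 ∧ f.1.norm.natDegree = 2 * d ∧
      ∑ p ∈ (finite_ord_ne_zero (f := f.1) (by simpa using hf0)).toFinset, ord p f.1 = 2 * d := by
  have hf0' : f.1 ≠ 0 := by simpa using hf0
  set Z := (finite_ord_ne_zero hf0').toFinset with hZ
  have h1 := finrank_le_inf_vanishingAt (degreeLE q d) (fun p => ord p f.1) Z (by simp [hZ])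
  rw [finrank_degreeLE hd.pos] at h1
  have h2 : degreeLE q d ⊓ vanishingAt (fun p => ord p f.1) ≤ Submodule.span ℝ {f.1} := by
    rintro g ⟨hg, hg'⟩
    obtain ⟨K, hK⟩ := exists_bound_of_vanishing hf0' hf (mem_vanishingAt.1 hg')
    obtain ⟨t, ht⟩ := Submodule.mem_span_singleton.1
      (hle (show (⟨g, hg⟩ : degreeLE q d) ∈ _ from ⟨K, hK⟩))
    exact Submodule.mem_span_singleton.2 ⟨t, congrArg Subtype.val ht⟩
  have h3 := (Submodule.finrank_mono h2).trans (finrank_span_singleton (K := ℝ) hf0').le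
  have h4 : Even (∑ p ∈ Z, ord p f.1) :=
    Finset.even_sum _ fun p _ => even_ord_of_nonneg p hf0' hf
  have h5 := mem_degreeLE_iff_natDegree_norm.1 f.2
  have h6 : 2 * d ≤ ∑ p ∈ Z, ord p f.1 := by
    obtain ⟨k, hk⟩ := h4
    omega
  have h7 := (sum_ord_le_sum_rootMultiplicity Z hf0').trans
    ((sum_rootMultiplicity_le _ _).trans (card_roots' _))
  exact ⟨realZeros_of_natDegree_le_sum_ord hf0' Z (by omega), by omega, by omega⟩

lemma exists_sq_eq_mul {d n : ℕ} (hd : d + 1 = 2 * n) {f : degreeLE q d} (hf0 : f ≠ 0)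
    {hf : ∀ p, 0 ≤ evLE d p f} (hle : dominated (evLE d) hf ≤ Submodule.span ℝ {f}) :
    ∃ h ∈ degreeLE q n, h ≠ 0 ∧ f.1 ∣ h ^ 2 := by
  have hf0' : f.1 ≠ 0 := by simpa using hf0
  obtain ⟨h1, h2, h3⟩ := realZeros_of_extremal (Nat.odd_iff.2 (by omega)) hf0 hle
  have heven : ∀ p, 2 * (ord p f.1 / 2) = ord p f.1 := fun p =>
    Nat.two_mul_div_two_of_even (even_ord_of_nonneg p hf0' hf)
  have h4 := finrank_le_inf_vanishingAt (degreeLE q n) (fun p => ord p f.1 / 2)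
    (finite_ord_ne_zero hf0').toFinset (by simp +contextual)
  rw [finrank_degreeLE (by omega)] at h4
  rw [← Finset.sum_congr rfl fun p _ => heven p, ← Finset.mul_sum] at h3
  obtain ⟨h, hh, hh0⟩ := (Submodule.ne_bot_iff _).1 (Submodule.one_le_finrank_iff.1
    (show 1 ≤ Module.finrank ℝ (degreeLE q n ⊓ vanishingAt fun p => ord p f.1 / 2 :
      Submodule ℝ (CurveAlg q)) by omega))
  refine ⟨h, hh.1, hh0, h1.dvd_sq hf0' fun p => ?_⟩
  rw [mem_vanishing_iff_le_ord (pow_ne_zero 2 hh0), ord_sq p hh0]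
  have := (mem_vanishing_iff_le_ord hh0).1 (mem_vanishingAt.1 hh.2 p)
  have := heven p
  omega

lemma exists_eq_algebraMap_linear {g : CurveAlg q} (hg : g.norm.natDegree = 2) :
    ∃ a c : ℝ, a ≠ 0 ∧ g = algebraMap ℝ[X] _ (C a * (X - C c)) := by
  have h1 : g ∈ degreeLE q 1 := mem_degreeLE_iff_natDegree_norm.2 (by omega)
  have him : g.im = 0 := by
    have := mem_degreeLT.1 h1.2
    exact degree_eq_bot.1 (Nat.WithBot.lt_zero_iff.1 this)
  have hg' : g = algebraMap ℝ[X] _ g.re := QuadraticAlgebra.ext rfl him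
  have hre : g.re.natDegree = 1 := by
    rw [hg', norm_algebraMap_eq, natDegree_pow] at hg
    omega
  have ha : g.re.coeff 1 ≠ 0 := by
    rw [← hre]; exact leadingCoeff_ne_zero.2 (fun h => by simp [h] at hre)
  refine ⟨g.re.coeff 1, -(g.re.coeff 0 / g.re.coeff 1), ha, hg'.trans (congrArg _ ?_)⟩
  rw [mul_sub, ← Polynomial.C_mul, mul_neg, mul_div_cancel₀ _ ha, Polynomial.C_neg, sub_neg_eq_add]
  exact eq_X_add_C_of_natDegree_le_one hre.le

lemma isRoot_of_sq_eq_mul {f h : CurveAlg q} {a c : ℝ} (hf0 : f ≠ 0) (hh0 : h ≠ 0)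
    (hpos : ∀ p, 0 ≤ ev p f)
    (hf : RealZeros f) (ha : a ≠ 0) (e : h ^ 2 = f * algebraMap ℝ[X] _ (C a * (X - C c))) :
    q.eval c = 0 := by
  have hl0 : C a * (X - C c) ≠ 0 := mul_ne_zero (C_ne_zero.2 ha) (X_sub_C_ne_zero c)
  rcases lt_trichotomy (q.eval c) 0 with hc | hc | hc
  · exfalso
    obtain ⟨p, rfl⟩ := exists_pt hc.le
    have hv : p.1.2 ≠ 0 := by
      intro hv
      have := p.2
      rw [hv] at this
      linarith
    have h1 := congrArg (ord p) e
    have h2 := (hasOrder_algebraMap p hl0).ord_eq (by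
      rwa [Ne, map_eq_zero_iff _ algebraMap_injective])
    rw [ord_sq p hh0, ord_mul p hf0 (by rwa [Ne, map_eq_zero_iff _ algebraMap_injective]), h2,
      rootMultiplicity_mul hl0, rootMultiplicity_C, rootMultiplicity_X_sub_C_self, ramification,
      if_neg hv] at h1
    obtain ⟨k, hk⟩ := even_ord_of_nonneg p hf0 hpos
    omega
  · exact hc
  · exfalso
    have h1 := congrArg QuadraticAlgebra.norm e
    rw [map_pow, map_mul, norm_algebraMap_eq] at h1
    have h2 : h.norm.eval c = 0 := by
      have := congrArg (eval c) h1
      simpa using this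
    rw [norm_eq, eval_add, eval_mul, eval_pow, eval_pow] at h2
    have him : h.im.eval c = 0 := by
      by_contra h0
      have : 0 < h.im.eval c ^ 2 := by positivity
      nlinarith [sq_nonneg (h.re.eval c)]
    have hre : h.re.eval c = 0 := by simpa [him] using h2
    obtain ⟨k, rfl⟩ := algebraMap_X_sub_C_dvd.2 ⟨hre, him⟩
    have hX : algebraMap ℝ[X] (CurveAlg q) (X - C c) ≠ 0 := by
      rw [Ne, map_eq_zero_iff _ algebraMap_injective]; exact X_sub_C_ne_zero c
    have h3 : algebraMap ℝ[X] (CurveAlg q) (X - C c) * k ^ 2 = f * algebraMap ℝ[X] _ (C a) := by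
      apply mul_left_cancel₀ hX
      rw [map_mul] at e
      linear_combination e
    have h4 := congrArg (eval c) (congrArg QuadraticAlgebra.norm h3)
    rw [map_mul, map_mul, norm_algebraMap_eq, norm_algebraMap_eq] at h4
    have h5 : f.norm.eval c = 0 := by
      simpa [ha] using h4
    have := hf.2 c ((mem_roots (norm_ne_zero hf0)).2 h5)
    linarith

/-- Up to a linear factor vanishing at a branch point, an extremal nonnegative function is a
square. -/
lemma exists_sq_eq_mul_of_extremal {d n : ℕ} (hd : d + 1 = 2 * n) {f : degreeLE q d} (hf0 : f ≠ 0)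
    {hf : ∀ p, 0 ≤ evLE d p f} (hle : dominated (evLE d) hf ≤ Submodule.span ℝ {f}) :
    ∃ h ∈ degreeLE q n, ∃ s c : ℝ, (s = 1 ∨ s = -1) ∧ q.eval c = 0 ∧
      (∀ p : Pt q, 0 ≤ s * (p.1.1 - c)) ∧ h.re.eval c = 0 ∧
      h ^ 2 = f.1 * algebraMap ℝ[X] _ (C s * (X - C c)) := by
  have hf0' : f.1 ≠ 0 := by simpa using hf0
  obtain ⟨h1, h2, -⟩ := realZeros_of_extremal (Nat.odd_iff.2 (by omega)) hf0 hle
  obtain ⟨h, hh, hh0, g, e⟩ := exists_sq_eq_mul hd hf0 hle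
  have hg0 : g ≠ 0 := by
    rintro rfl
    exact hh0 (by simpa using e)
  have hg2 : g.norm.natDegree = 2 := by
    have h3 := congrArg (fun k => (QuadraticAlgebra.norm k).natDegree) e
    simp only [map_pow, map_mul] at h3
    rw [natDegree_pow, natDegree_mul (norm_ne_zero hf0') (norm_ne_zero hg0), h2] at h3
    obtain ⟨k, hk⟩ := even_natDegree_norm h
    have h4 := mem_degreeLE_iff_natDegree_norm.1 hh
    obtain ⟨l, hl⟩ := even_natDegree_norm g
    omega
  obtain ⟨a, c, ha, rfl⟩ := exists_eq_algebraMap_linear hg2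
  have hc := isRoot_of_sq_eq_mul hf0' hh0 hf h1 ha e
  have hw : ∀ p : Pt q, 0 ≤ a * (p.1.1 - c) := fun p => by
    have := nonneg_of_nonneg_mul hf0' hf (fun p => by rw [← e, map_pow]; positivity) p
    simpa using this
  have hre : h.re.eval c = 0 := by
    have h5 := congrArg (ev (⟨(c, 0), by simp [hc]⟩ : Pt q)) e
    rw [map_pow, map_mul, ev_algebraMap] at h5
    simpa [ev_apply] using h5
  have hab : 0 < |a| := abs_pos.2 ha
  refine ⟨(√|a|)⁻¹ • h, Submodule.smul_mem _ _ hh, a / |a|, c, ?_, hc, fun p => ?_, ?_, ?_⟩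
  · rcases abs_cases a with ⟨h6, -⟩ | ⟨h6, -⟩
    · left; rw [h6, div_self ha]
    · right; rw [h6, div_neg, div_self ha]
  · rw [div_mul_eq_mul_div]
    exact div_nonneg (hw p) hab.le
  · simp [hre]
  · have h7 : algebraMap ℝ[X] (CurveAlg q) (C (a / |a|) * (X - C c)) =
        (|a|)⁻¹ • algebraMap ℝ[X] (CurveAlg q) (C a * (X - C c)) := by
      rw [div_eq_inv_mul, Polynomial.C_mul, mul_assoc, ← smul_eq_C_mul]
      ext <;> simp
    rw [h7, mul_smul_comm, ← e, _root_.smul_pow, inv_pow, Real.sq_sqrt hab.le]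

end CurveAlg

section UnivariateSumsOfSquares

open Filter Topology

/-- Sums of squares of elements of `S`. -/
def sos {R : Type*} [CommSemiring R] (S : Set R) : AddSubmonoid R :=
  AddSubmonoid.closure ((· ^ 2) '' S)

lemma sq_mem_sos {R : Type*} [CommSemiring R] {S : Set R} {a : R} (ha : a ∈ S) : a ^ 2 ∈ sos S :=
  AddSubmonoid.subset_closure ⟨a, ha, rfl⟩

lemma sos_mono {R : Type*} [CommSemiring R] {S T : Set R} (h : S ⊆ T) : sos S ≤ sos T :=
  AddSubmonoid.closure_mono (Set.image_mono h)

lemma map_mul_sq_mem_sos {R R' : Type*} [CommSemiring R] [CommSemiring R'] {S : Set R} {T : Set R'}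
    (φ : R →+* R') {b : R'} (h : ∀ a ∈ S, φ a * b ∈ T) {x : R} (hx : x ∈ sos S) :
    φ x * b ^ 2 ∈ sos T := by
  induction hx using AddSubmonoid.closure_induction with
  | mem x hx =>
    obtain ⟨a, ha, rfl⟩ := hx
    simpa [mul_pow] using sq_mem_sos (h a ha)
  | zero => simp
  | add x y _ _ hx hy => rw [map_add, add_mul]; exact add_mem hx hy

lemma eval_nonneg_of_forall_ne {p : ℝ[X]} {c : ℝ} (h : ∀ x ≠ c, 0 ≤ p.eval x) (x : ℝ) :
    0 ≤ p.eval x := by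
  rcases eq_or_ne x c with rfl | hx
  · exact ge_of_tendsto (p.continuous.continuousAt.tendsto.mono_left nhdsWithin_le_nhds)
      (eventually_mem_nhdsWithin.mono fun y hy => h y hy : ∀ᶠ y in 𝓝[≠] x, 0 ≤ p.eval y)
  · exact h x hx

lemma exists_eq_add_sq_mul {p : ℝ[X]} (hp : ∀ x, 0 ≤ p.eval x) :
    ∃ a c : ℝ, 0 ≤ a ∧ ∃ g : ℝ[X], p = C a + (X - C c) ^ 2 * g ∧ ∀ x, 0 ≤ g.eval x := by
  obtain ⟨c, hc⟩ := p.exists_forall_norm_le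
  have hc' : ∀ y, p.eval c ≤ p.eval y := fun y => by
    simpa [abs_of_nonneg (hp _)] using hc y
  obtain ⟨g, hg⟩ := dvd_iff_isRoot.2 (show (p - C (p.eval c)).IsRoot c by simp)
  have hgc : g.eval c = 0 := by
    have h1 : p.derivative.eval c = 0 :=
      IsLocalMin.hasDerivAt_eq_zero (f := fun x => p.eval x) (Eventually.of_forall hc')
        (p.hasDerivAt c)
    have h2 := congrArg (fun r => eval c (derivative r)) hg
    simpa [h1, derivative_mul] using h2.symm
  obtain ⟨k, rfl⟩ := dvd_iff_isRoot.2 hgc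
  have hpk : p = C (p.eval c) + (X - C c) ^ 2 * k := by linear_combination hg
  refine ⟨p.eval c, c, hp c, k, hpk, eval_nonneg_of_forall_ne (c := c) fun x hx => ?_⟩
  have h3 := congrArg (eval x) hpk
  simp only [eval_add, eval_C, eval_mul, eval_pow, eval_sub, eval_X] at h3
  have h4 : 0 < (x - c) ^ 2 := by have := sub_ne_zero.2 hx; positivity
  exact nonneg_of_mul_nonneg_right (by linarith [hc' x]) h4

/-- A nonnegative real polynomial in one variable is a sum of squares. -/
lemma exists_mem_sos_of_eval_nonneg {p : ℝ[X]} (hp : ∀ x, 0 ≤ p.eval x) :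
    ∃ M, p ∈ sos (degreeLT ℝ M : Set ℝ[X]) := by
  induction hn : p.natDegree using Nat.strong_induction_on generalizing p with
  | _ n ih =>
  obtain ⟨a, c, ha, g, rfl, hg⟩ := exists_eq_add_sq_mul hp
  have hC : ∀ M, C a ∈ sos (degreeLT ℝ (M + 1) : Set ℝ[X]) := fun M => by
    rw [← Real.sq_sqrt ha, C_pow]
    exact sq_mem_sos (mem_degreeLT.2 (degree_C_le.trans_lt (by exact_mod_cast Nat.succ_pos M)))
  rcases eq_or_ne g 0 with rfl | hg0
  · exact ⟨1, by simpa using hC 0⟩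
  have hdeg : g.natDegree < n := by
    rw [← hn, natDegree_C_add, natDegree_mul (pow_ne_zero 2 (X_sub_C_ne_zero c)) hg0,
      natDegree_pow, natDegree_X_sub_C]
    omega
  obtain ⟨M, hM⟩ := ih _ hdeg hg rfl
  refine ⟨M + 1, add_mem (hC M) ?_⟩
  rw [mul_comm]
  refine map_mul_sq_mem_sos (RingHom.id _) (fun r hr => ?_) hM
  rw [SetLike.mem_coe, mem_degreeLT] at *
  rcases eq_or_ne r 0 with rfl | hr0
  · simp
  rw [degree_eq_natDegree hr0] at hr
  rw [RingHom.id_apply, degree_mul, degree_X_sub_C, degree_eq_natDegree hr0]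
  have : r.natDegree < M := by exact_mod_cast hr
  exact_mod_cast Nat.succ_lt_succ this

lemma one_sub_pow_mul_le_one {t : ℝ} (h0 : 0 ≤ t) (h1 : t ≤ 1) (n : ℕ) :
    (1 - t) ^ n * (1 + n * t) ≤ 1 := by
  have h2 := one_add_mul_le_pow (a := t) (by linarith) n
  calc (1 - t) ^ n * (1 + n * t) ≤ (1 - t) ^ n * (1 + t) ^ n :=
        mul_le_mul_of_nonneg_left h2 (pow_nonneg (by linarith) n)
    _ = (1 - t ^ 2) ^ n := by rw [← mul_pow]; ring
    _ ≤ 1 := pow_le_one₀ (by nlinarith) (by nlinarith [sq_nonneg t])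

lemma exists_pow_mul_crossing {P P₁ : ℝ → ℝ} {Z B μ : ℝ} (hP : ∀ z, P z = 1 + z * P₁ z)
    (hZ : 0 < Z) (hB : 1 ≤ B) (hμ : 0 < μ) (hB' : ∀ z ∈ Set.Icc (-1) Z, P₁ z ≤ B)
    (hμ' : ∀ z ≤ 0, μ ≤ P z) (hZ' : ∀ z, Z ≤ z → P z ≤ 0) :
    ∃ n : ℕ, ∀ z, (0 < z → (1 - z / Z) ^ (2 * n) * P z ≤ 1) ∧
      (z < 0 → 1 ≤ (1 - z / Z) ^ (2 * n) * P z) := by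
  obtain ⟨n, hn⟩ := exists_nat_ge (Z * (2 * B + 2 * B / μ))
  set N : ℝ := ((2 * n : ℕ) : ℝ) / Z with hN
  have hN' : 2 * B + 2 * B / μ ≤ N := by
    rw [hN, le_div_iff₀ hZ]
    push_cast
    have : (0 : ℝ) ≤ n := n.cast_nonneg
    linarith
  have hBμ : 0 < 2 * B / μ := by positivity
  refine ⟨n, fun z => ⟨fun hz => ?_, fun hz => ?_⟩⟩
  · have h0 : 0 ≤ (1 - z / Z) ^ (2 * n) := by rw [pow_mul]; positivity
    rcases le_total Z z with h | h
    · exact (mul_nonpos_of_nonneg_of_nonpos h0 (hZ' z h)).trans zero_le_one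
    · refine le_trans (mul_le_mul_of_nonneg_left ?_ h0)
        (one_sub_pow_mul_le_one (t := z / Z) (by positivity) ((div_le_one hZ).2 h) (2 * n))
      rw [hP, ← mul_div_assoc, mul_div_right_comm, ← hN]
      have := mul_le_mul_of_nonneg_left (hB' z ⟨by linarith, h⟩) hz.le
      nlinarith
  · have h1 := one_add_mul_le_pow (a := -z / Z)
      (by have : 0 ≤ -z / Z := div_nonneg (by linarith) hZ.le
          linarith) (2 * n)
    rw [← mul_div_assoc, mul_div_right_comm, ← hN] at h1
    have h2 := hμ' z hz.le
    have h3 : (1 + N * -z) * P z ≤ (1 - z / Z) ^ (2 * n) * P z := by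
      refine mul_le_mul_of_nonneg_right ?_ (hμ.le.trans h2)
      rwa [sub_eq_add_neg, ← neg_div]
    refine le_trans ?_ h3
    rcases le_total (-z * (2 * B)) 1 with h | h
    · have h4 := mul_le_mul_of_nonneg_left (hB' z ⟨by nlinarith, by linarith⟩)
        (show 0 ≤ -z by linarith)
      have h5 : 1 + z * B ≤ P z := by rw [hP]; linarith
      have h6 : (1 + N * -z) * (1 + z * B) ≤ (1 + N * -z) * P z :=
        mul_le_mul_of_nonneg_left h5 (by nlinarith)
      nlinarith [mul_nonneg (show 0 ≤ -z by linarith) (show 0 ≤ N - 2 * B by linarith),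
        mul_nonneg (mul_nonneg (show 0 ≤ -z by linarith) (show 0 ≤ N by linarith))
          (show 0 ≤ 1 - -z * (2 * B) by linarith)]
    · have h4 : (1 + N * -z) * μ ≤ (1 + N * -z) * P z :=
        mul_le_mul_of_nonneg_left h2 (by nlinarith)
      have h5 : 2 * B / μ * -z ≤ N * -z := mul_le_mul_of_nonneg_right (by linarith) (by linarith)
      have h6 : 2 * B / μ * -z * μ = -z * (2 * B) := by field_simp
      nlinarith [mul_le_mul_of_nonneg_right h5 hμ.le]

end UnivariateSumsOfSquares

namespace CurveAlg

open Filter Topology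

variable {q : ℝ[X]} [hq : SmoothQuartic q]

lemma exists_forall_ge_eval_nonneg (c : ℝ) {s : ℝ} (hs : s = 1 ∨ s = -1) :
    ∃ Z : ℝ, 0 < Z ∧ ∀ z, Z ≤ z → 0 ≤ q.eval (c + s * z) := by
  have h : Tendsto (fun z => q.eval (c + s * z)) atTop atTop := by
    rcases hs with rfl | rfl
    · simpa [Function.comp_def] using (tendsto_eval_atTop (q := q)).comp
        (tendsto_atTop_add_const_left atTop c tendsto_id)
    · refine ((tendsto_eval_neg_atTop (q := q)).comp
        (tendsto_atTop_add_const_left atTop (-c) tendsto_id)).congr fun z => ?_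
      simp only [Function.comp_apply, id_eq]
      congr 1
      ring
  obtain ⟨Z, hZ⟩ := (tendsto_atTop.1 h 0).exists_forall_of_atTop
  exact ⟨max Z 1, by positivity, fun z hz => hZ z ((le_max_left _ _).trans hz)⟩

lemma exists_sos_identity {c s : ℝ} (hs : s = 1 ∨ s = -1) (hc : q.eval c = 0)
    (hw : ∀ u, q.eval u ≤ 0 → 0 ≤ s * (u - c)) :
    ∃ M, ∃ A ∈ sos (degreeLT ℝ M : Set ℝ[X]), ∃ b ∈ degreeLT ℝ M,
      C s * (X - C c) = A * (C s * (X - C c)) ^ 2 + b ^ 2 * (-q) := by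
  have hs2 : s * s = 1 := by rcases hs with rfl | rfl <;> norm_num
  have hs0 : s ≠ 0 := by rintro rfl; norm_num at hs2
  obtain ⟨r, hr, hr0⟩ := hq.simple_root c hc
  have hr3 : r.natDegree = 3 := by
    have h := hq.natDegree_eq
    rw [hr, natDegree_mul (X_sub_C_ne_zero c) (fun h => by simp [h] at hr0),
      natDegree_X_sub_C] at h
    omega
  set R : ℝ[X] := C (-s) * r.comp (C c + C s * X) with hR
  have hRz : ∀ z, R.eval z = -s * r.eval (c + s * z) := fun z => by simp [hR]
  have hzR : ∀ z, z * R.eval z = -q.eval (c + s * z) := fun z => by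
    rw [hRz, hr]
    simp
    ring
  have hneg : ∀ z < 0, 0 < R.eval z := by
    intro z hz
    have h1 : 0 < q.eval (c + s * z) := by
      by_contra! h
      have := hw _ h
      rw [add_sub_cancel_left, ← mul_assoc, hs2] at this
      linarith
    have := hzR z
    by_contra! h
    nlinarith
  have hR0 : 0 < R.eval 0 := by
    refine lt_of_le_of_ne ?_ (by simpa [hRz, hs0, eq_comm] using hr0)
    refine ge_of_tendsto (R.continuous.continuousAt.tendsto.mono_left
      (nhdsWithin_le_nhds (s := Set.Iio 0))) ?_
    filter_upwards [self_mem_nhdsWithin] with z hz using (hneg z hz).le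
  obtain ⟨μ, hμ, hμ'⟩ : ∃ μ : ℝ, 0 < μ ∧ ∀ z ≤ 0, μ ≤ R.eval z := by
    have h1 : Tendsto (fun x => |eval x (R.comp (-X))|) atTop atTop := by
      refine abs_tendsto_atTop _ ?_
      rw [← natDegree_pos_iff_degree_pos, natDegree_comp, hR, natDegree_C_mul (neg_ne_zero.2 hs0),
        natDegree_comp, natDegree_C_add, natDegree_C_mul_X _ hs0, hr3, natDegree_neg, natDegree_X]
      norm_num
    obtain ⟨T, hT⟩ := (tendsto_atTop.1 h1 1).exists_forall_of_atTop
    obtain ⟨m, hm, hm'⟩ := (isCompact_Icc (a := -max T 0) (b := 0)).exists_isMinOn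
      ⟨0, by simp⟩ R.continuous.continuousOn
    have hpos : 0 < R.eval m := by
      rcases hm.2.lt_or_eq with h | h
      · exact hneg m h
      · rwa [h]
    refine ⟨min 1 (R.eval m), by positivity, fun z hz => ?_⟩
    by_cases h : z ∈ Set.Icc (-max T 0) 0
    · exact (min_le_right _ _).trans (hm' h)
    · have h2 : z < -max T 0 := by
        by_contra! h3
        exact h ⟨h3, hz⟩
      have h3 := hT (-z) (by linarith [le_max_left T 0])
      have h4 := hneg z (by linarith [le_max_right T 0])
      rw [eval_comp, eval_neg, eval_X, neg_neg, abs_of_pos h4] at h3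
      exact (min_le_left _ _).trans h3
  obtain ⟨Z, hZ, hZ'⟩ := exists_forall_ge_eval_nonneg (q := q) c hs
  obtain ⟨B, hB⟩ := (isCompact_Icc (a := -1) (b := Z)).bddAbove_image
    ((continuous_const (y := (R.eval 0)⁻¹)).mul R.divX.continuous).continuousOn
  obtain ⟨n, hn⟩ := exists_pow_mul_crossing (P := fun z => (R.eval 0)⁻¹ * R.eval z)
    (P₁ := fun z => (R.eval 0)⁻¹ * R.divX.eval z) (Z := Z) (B := max B 1)
    (μ := (R.eval 0)⁻¹ * μ)
    (fun z => by
      have h := congrArg (eval z) R.divX_mul_X_add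
      rw [eval_add, eval_mul, eval_X, eval_C, coeff_zero_eq_eval_zero] at h
      rw [← h]
      field_simp
      ring)
    hZ (le_max_right _ _) (by positivity)
    (fun z hz => (hB (Set.mem_image_of_mem _ hz)).trans (le_max_left _ _))
    (fun z hz => mul_le_mul_of_nonneg_left (hμ' z hz) (by positivity))
    (fun z hz => mul_nonpos_of_nonneg_of_nonpos (by positivity) (by
      have := hzR z
      have := hZ' z hz
      by_contra! h
      nlinarith))
  set w : ℝ[X] := C s * (X - C c) with hwdef
  have hw0 : w ≠ 0 := mul_ne_zero (C_ne_zero.2 hs0) (X_sub_C_ne_zero c)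
  have hRw : w * R.comp w = -q := by
    refine Polynomial.funext fun u => ?_
    have := hzR (w.eval u)
    rw [eval_mul, eval_comp, this, eval_neg]
    simp [hwdef, ← mul_assoc, hs2]
  set b : ℝ[X] := C (√(R.eval 0)⁻¹) * (1 - C Z⁻¹ * w) ^ n with hb
  have hbev : ∀ u, (b ^ 2 * R.comp w).eval u =
      (1 - w.eval u / Z) ^ (2 * n) * ((R.eval 0)⁻¹ * R.eval (w.eval u)) := fun u => by
    simp only [hb, eval_mul, eval_pow, eval_C, eval_sub, eval_one, eval_comp, mul_pow]
    rw [Real.sq_sqrt (by positivity), ← pow_mul]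
    ring
  obtain ⟨A, hA⟩ : w ∣ 1 - b ^ 2 * R.comp w := by
    rw [hwdef, (isUnit_C.2 hs0.isUnit).mul_left_dvd, dvd_iff_isRoot, IsRoot, eval_sub, hbev]
    simp [hwdef, hR0.ne']
  have hApos : ∀ u, 0 ≤ A.eval u := by
    refine eval_nonneg_of_forall_ne (c := c) fun u hu => ?_
    have h1 := congrArg (eval u) hA
    rw [eval_sub, hbev, eval_one, eval_mul (p := w)] at h1
    have h2 : w.eval u ≠ 0 := by simp [hwdef, hs0, sub_ne_zero.2 hu]
    rcases lt_or_gt_of_ne h2 with h | h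
    · have := (hn (w.eval u)).2 h
      by_contra! h3
      nlinarith
    · have := (hn (w.eval u)).1 h
      by_contra! h3
      nlinarith
  obtain ⟨M, hM⟩ := exists_mem_sos_of_eval_nonneg hApos
  refine ⟨max M (b.natDegree + 1), A, sos_mono (SetLike.coe_subset_coe.2
    (degreeLT_mono (le_max_left _ _))) hM, b, degreeLT_mono (le_max_right _ _)
    (mem_degreeLT.2 (degree_le_natDegree.trans_lt (by exact_mod_cast Nat.lt_succ_self _))), ?_⟩
  rw [← hRw]
  linear_combination w * hA

variable (q) in
lemma exists_uniform_sos_identity :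
    ∃ M, ∀ c s : ℝ, (s = 1 ∨ s = -1) → q.eval c = 0 → (∀ u, q.eval u ≤ 0 → 0 ≤ s * (u - c)) →
    ∃ A ∈ sos (degreeLT ℝ M : Set ℝ[X]), ∃ b ∈ degreeLT ℝ M,
      C s * (X - C c) = A * (C s * (X - C c)) ^ 2 + b ^ 2 * (-q) := by
  classical
  have h : ∀ x : ℝ × ℝ, ∃ M, (x.2 = 1 ∨ x.2 = -1) → q.eval x.1 = 0 →
      (∀ u, q.eval u ≤ 0 → 0 ≤ x.2 * (u - x.1)) →
      ∃ A ∈ sos (degreeLT ℝ M : Set ℝ[X]), ∃ b ∈ degreeLT ℝ M,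
        C x.2 * (X - C x.1) = A * (C x.2 * (X - C x.1)) ^ 2 + b ^ 2 * (-q) := by
    intro x
    by_cases hx : (x.2 = 1 ∨ x.2 = -1) ∧ q.eval x.1 = 0 ∧
        ∀ u, q.eval u ≤ 0 → 0 ≤ x.2 * (u - x.1)
    · obtain ⟨M, hM⟩ := exists_sos_identity hx.1 hx.2.1 hx.2.2
      exact ⟨M, fun _ _ _ => hM⟩
    · exact ⟨0, fun h1 h2 h3 => absurd ⟨h1, h2, h3⟩ hx⟩
  choose M hM using h
  refine ⟨(q.roots.toFinset ×ˢ ({1, -1} : Finset ℝ)).sup M, fun c s hs hc hw => ?_⟩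
  obtain ⟨A, hA, b, hb, e⟩ := hM (c, s) hs hc hw
  have hle := degreeLT_mono (R := ℝ) (Finset.le_sup (f := M) (show (c, s) ∈
    q.roots.toFinset ×ˢ ({1, -1} : Finset ℝ) by simp [hq.monic.ne_zero, hc, hs]))
  exact ⟨A, sos_mono (SetLike.coe_subset_coe.2 hle) hA, b, hle hb, e⟩

end CurveAlg

namespace CurveAlg

open QuadraticAlgebra

variable {q : ℝ[X]} [hq : SmoothQuartic q]

lemma algebraMap_mem_degreeLE {M : ℕ} {a : ℝ[X]} (ha : a ∈ degreeLT ℝ M) :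
    algebraMap ℝ[X] (CurveAlg q) a ∈ degreeLE q M := by
  rw [mem_degreeLE_iff_natDegree_norm, norm_algebraMap_eq, natDegree_pow]
  have := natDegree_le_of_degree_le (mem_degreeLT.1 ha).le
  omega

lemma degreeLE_mono {d e : ℕ} (h : d ≤ e) : degreeLE q d ≤ degreeLE q e := fun f hf => by
  rw [mem_degreeLE_iff_natDegree_norm] at *
  omega

lemma natDegree_norm_omega : (omega : CurveAlg q).norm.natDegree = 4 := by
  simp [norm_eq, hq.natDegree_eq]

lemma exists_mul_eq_mul_omega {n : ℕ} {h : CurveAlg q} (hh : h ∈ degreeLE q n) {s c : ℝ}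
    (hs : s ≠ 0) (hc : q.eval c = 0) (hre : h.re.eval c = 0) :
    ∃ k ∈ degreeLE q (n + 1), k * algebraMap ℝ[X] _ (C s * (X - C c)) = h * omega := by
  have hu : IsUnit (algebraMap ℝ[X] (CurveAlg q) (C s)) := (isUnit_C.2 hs.isUnit).map _
  obtain ⟨k, hk⟩ : algebraMap ℝ[X] (CurveAlg q) (C s * (X - C c)) ∣ h * omega := by
    rw [map_mul, hu.mul_left_dvd, algebraMap_X_sub_C_dvd]
    simp [hc, hre]
  rw [mul_comm _ k] at hk
  refine ⟨k, ?_, hk.symm⟩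
  rcases eq_or_ne k 0 with rfl | hk0
  · exact zero_mem _
  have h1 := congrArg QuadraticAlgebra.norm hk
  rw [map_mul, map_mul, norm_algebraMap_eq] at h1
  have h2 : (C s * (X - C c)).natDegree = 1 := by
    rw [natDegree_C_mul hs, natDegree_X_sub_C]
  have h3 : C s * (X - C c) ≠ 0 := by
    rintro h; simp [h] at h2
  have h5 := natDegree_mul (norm_ne_zero hk0) (pow_ne_zero 2 h3)
  rw [← h1, natDegree_pow, h2] at h5
  have h4 := (natDegree_mul_le (p := h.norm) (q := (omega : CurveAlg q).norm))
  rw [natDegree_norm_omega] at h4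
  rw [mem_degreeLE_iff_natDegree_norm] at *
  omega

variable (q) in
/-- A nonnegative function is a sum of squares of functions of about half its degree. -/
theorem exists_forall_mem_sos : ∃ M, ∀ d n, d + 1 = 2 * n → ∀ f ∈ degreeLE q d,
    (∀ p, 0 ≤ ev p f) → f ∈ sos (degreeLE q (n + M) : Set (CurveAlg q)) := by
  obtain ⟨M, hM⟩ := exists_uniform_sos_identity q
  refine ⟨M + 1, fun d n hd f hfd hf => ?_⟩
  refine induction_on_extremal (φ := evLE d)
    (Q := fun f => f.1 ∈ sos (degreeLE q (n + (M + 1)) : Set (CurveAlg q)))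
    (fun f hf => Subtype.ext (eq_zero_of_ev_eq_zero hf)) (zero_mem _)
    (fun f g hf hg => add_mem hf hg) (fun t f ht hf => ?_) (fun f hf0 hf hle => ?_)
    (⟨f, hfd⟩ : degreeLE q d) hf
  · have : (t • f).1 = RingHom.id _ f.1 * (algebraMap ℝ (CurveAlg q) √t) ^ 2 := by
      rw [← map_pow, Real.sq_sqrt ht, mul_comm, ← Algebra.smul_def]; rfl
    rw [this]
    refine map_mul_sq_mem_sos _ (fun a ha => ?_) hf
    rw [mul_comm, ← Algebra.smul_def]
    exact Submodule.smul_mem _ _ ha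
  · obtain ⟨h, hh, s, c, hs, hc, hw, hre, e⟩ := exists_sq_eq_mul_of_extremal hd hf0 hle
    obtain ⟨A, hA, b, hb, e'⟩ := hM c s hs hc fun u hu => by
      obtain ⟨p, rfl⟩ := exists_pt hu
      exact hw p
    have hs0 : s ≠ 0 := by rcases hs with rfl | rfl <;> norm_num
    obtain ⟨k, hk, hk'⟩ := exists_mul_eq_mul_omega hh hs0 hc hre
    have key : f.1 = algebraMap _ _ A * h ^ 2 + (algebraMap _ _ b * k) ^ 2 := by
      have hw0 : algebraMap ℝ[X] (CurveAlg q) (C s * (X - C c)) ≠ 0 := by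
        rw [Ne, map_eq_zero_iff _ algebraMap_injective]
        exact mul_ne_zero (C_ne_zero.2 hs0) (X_sub_C_ne_zero c)
      have e2 := congrArg (algebraMap ℝ[X] (CurveAlg q)) e'
      rw [map_add, map_mul _ A, map_mul _ (b ^ 2), ← omega_sq, map_pow, map_pow] at e2
      refine mul_right_cancel₀ (pow_ne_zero 2 hw0) ?_
      set w := algebraMap ℝ[X] (CurveAlg q) (C s * (X - C c))
      linear_combination -w * e + h ^ 2 * e2 - algebraMap ℝ[X] (CurveAlg q) b ^ 2 *
        (k * w + h * omega) * hk'
    change f.1 ∈ _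
    rw [key]
    refine add_mem (map_mul_sq_mem_sos _ (fun a ha => ?_) hA) (sq_mem_sos ?_)
    · exact degreeLE_mono (by omega) (mul_mem_degreeLE (algebraMap_mem_degreeLE ha) hh)
    · exact degreeLE_mono (by omega) (mul_mem_degreeLE (algebraMap_mem_degreeLE hb) hk)

end CurveAlg

section Comparison

open CurveAlg QuadraticAlgebra

variable {q : ℝ[X]}

lemma degree_C_add_C_mul_X_lt (a b : ℝ[X]) :
    (C a + C b * X : ℝ[X][X]).degree < (curvePoly q).degree := by
  rw [curvePoly, degree_X_pow_add_C (by norm_num), add_comm]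
  exact degree_linear_le.trans_lt (by norm_num)

lemma curveRep_mk (a b : ℝ[X]) :
    curveRep q (AdjoinRoot.mk _ (C a + C b * X)) = C a + C b * X := by
  rw [curveRep, AdjoinRoot.modByMonicHom_mk,
    (modByMonic_eq_self_iff (curvePoly_monic q)).2 (degree_C_add_C_mul_X_lt a b)]

variable (q) in
/-- The comparison map from pairs `a + b y` to the coordinate ring. -/
def toCurveRing : CurveAlg q →ₐ[ℝ[X]] CurveRing q :=
  QuadraticAlgebra.lift ⟨AdjoinRoot.root _, by
    have h : AdjoinRoot.mk (curvePoly q) (X ^ 2 + C q) = 0 := AdjoinRoot.mk_self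
    rw [map_add, map_pow, AdjoinRoot.mk_X, AdjoinRoot.mk_C] at h
    rw [zero_smul, add_zero, neg_smul, Algebra.smul_def, mul_one, ← sq]
    exact eq_neg_of_add_eq_zero_left h⟩

lemma toCurveRing_apply (f : CurveAlg q) :
    toCurveRing q f = AdjoinRoot.mk _ (C f.re + C f.im * X) := by
  rw [map_add, map_mul, AdjoinRoot.mk_C, AdjoinRoot.mk_C, AdjoinRoot.mk_X, toCurveRing,
    QuadraticAlgebra.lift_apply_apply, Algebra.smul_def, mul_one, Algebra.smul_def]
  rfl

@[simp] lemma repA_toCurveRing (f : CurveAlg q) : repA q (toCurveRing q f) = f.re := by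
  rw [toCurveRing_apply, repA, curveRep_mk]; simp

@[simp] lemma repB_toCurveRing (f : CurveAlg q) : repB q (toCurveRing q f) = f.im := by
  rw [toCurveRing_apply, repB, curveRep_mk]; simp

lemma toCurveRing_surjective : Function.Surjective (toCurveRing q) := by
  intro f
  refine ⟨⟨repA q f, repB q f⟩, ?_⟩
  rw [toCurveRing_apply]
  conv_rhs => rw [← AdjoinRoot.mk_leftInverse (curvePoly_monic q) f]
  congr 1
  have h : (curveRep q f).degree ≤ 1 := by
    obtain ⟨p, rfl⟩ := AdjoinRoot.mk_surjective f
    rw [curveRep, AdjoinRoot.modByMonicHom_mk]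
    have := degree_modByMonic_lt p (curvePoly_monic q)
    rw [curvePoly, degree_X_pow_add_C (by norm_num)] at this
    exact Order.le_of_lt_succ this
  rw [add_comm]
  exact (eq_X_add_C_of_degree_le_one h).symm

lemma mem_degreeLE_of_curveDelta_le {f : CurveAlg q} {d : ℕ}
    (h : curveDelta q (toCurveRing q f) ≤ d) : f ∈ degreeLE q d := by
  rw [curveDelta, repA_toCurveRing, repB_toCurveRing] at h
  rw [mem_degreeLE_iff, mem_degreeLT, mem_degreeLT]
  split_ifs at h with h0
  · refine ⟨degree_le_natDegree.trans_lt (by exact_mod_cast Nat.lt_succ_of_le h), ?_⟩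
    rw [h0, degree_zero]
    exact WithBot.bot_lt_coe _
  · have h1 := (le_max_left _ _).trans h
    have h2 := (le_max_right _ _).trans h
    exact ⟨degree_le_natDegree.trans_lt (by exact_mod_cast Nat.lt_succ_of_le h1),
      degree_le_natDegree.trans_lt
        (by exact_mod_cast (show f.im.natDegree < d - 1 by omega))⟩

lemma curveDelta_le_of_mem_degreeLE {f : CurveAlg q} {d : ℕ} (h : f ∈ degreeLE q d) :
    curveDelta q (toCurveRing q f) ≤ d := by
  rw [mem_degreeLE_iff, mem_degreeLT, mem_degreeLT] at h
  have h1 : f.re.natDegree ≤ d :=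
    natDegree_le_of_degree_le (Order.le_of_lt_succ (by exact_mod_cast h.1))
  rw [curveDelta, repA_toCurveRing, repB_toCurveRing]
  split_ifs with h0
  · exact h1
  · have h2 := h.2
    rw [degree_eq_natDegree h0] at h2
    have : f.im.natDegree < d - 1 := by exact_mod_cast h2
    exact max_le h1 (by omega)

lemma isSosLe_of_mem_sos {f : CurveAlg q} {d : ℕ} (hf : f ∈ sos (degreeLE q d : Set (CurveAlg q))) :
    IsSosLe q (toCurveRing q f) d := by
  obtain ⟨l, hl, rfl⟩ := AddSubmonoid.exists_list_of_mem_closure hf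
  choose g hg e using hl
  refine ⟨l.length, fun i => toCurveRing q (g l[i] (List.getElem_mem _)), ?_, fun i =>
    curveDelta_le_of_mem_degreeLE (hg _ _)⟩
  simp only [← map_pow, ← map_sum]
  congr 1
  rw [← List.sum_ofFn]
  congr 1
  refine List.ext_getElem (by simp) fun i h1 h2 => ?_
  simp only [List.getElem_ofFn]
  exact (e _ _).symm

lemma smoothQuartic_of_squarefree (hmonic : q.Monic) (hdeg : q.natDegree = 4)
    (hsep : Squarefree (q.map (algebraMap ℝ ℂ))) (hindef : ∃ x : ℝ, q.eval x < 0) :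
    SmoothQuartic q where
  monic := hmonic
  natDegree_eq := hdeg
  exists_neg := hindef
  simple_root c hc := by
    obtain ⟨r, rfl⟩ := dvd_iff_isRoot.2 hc
    refine ⟨r, rfl, fun hr => ?_⟩
    obtain ⟨k, rfl⟩ := dvd_iff_isRoot.2 hr
    have := hsep ((X - C c).map (algebraMap ℝ ℂ))
      ⟨k.map (algebraMap ℝ ℂ), by simp only [Polynomial.map_mul, mul_assoc]⟩
    rw [Polynomial.map_sub, map_X, map_C] at this
    exact not_isUnit_X_sub_C _ this

end Comparison

/-- Theorem 2.8 / `thmsum`: there is an integer `N ≥ 1` such that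
every nonzero psd `f ∈ ℝ[C]` satisfies `θ(f) ≤ N + ⌈δ(f)/2⌉`. -/
theorem stability_bound_for_genus_one_curve
    (q : Polynomial ℝ) (hmonic : q.Monic) (hdeg : q.natDegree = 4)
    (hsep : Squarefree (q.map (algebraMap ℝ ℂ)))
    (hindef : ∃ x : ℝ, q.eval x < 0) :
    ∃ N : ℕ, 1 ≤ N ∧ ∀ f : CurveRing q, f ≠ 0 → IsPsd q f →
      curveTheta q f ≤ ((N + (curveDelta q f + 1) / 2 : ℕ) : ℕ∞) := by
  have := smoothQuartic_of_squarefree hmonic hdeg hsep hindef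
  obtain ⟨M, hM⟩ := CurveAlg.exists_forall_mem_sos q
  refine ⟨M + 1, by omega, fun f _ hf => ?_⟩
  obtain ⟨g, rfl⟩ := toCurveRing_surjective f
  set D := curveDelta q (toCurveRing q g) with hD
  have hg := hM (2 * (D / 2) + 1) (D / 2 + 1) (by omega) g
    (mem_degreeLE_of_curveDelta_le (by omega))
    fun p => by simpa [CurveAlg.ev_apply] using hf p.1.1 p.1.2 p.2
  exact sInf_le ⟨_, rfl, isSosLe_of_mem_sos
    (sos_mono (SetLike.coe_subset_coe.2 (CurveAlg.degreeLE_mono (by omega))) hg)⟩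

end
end

section
/- Every psd element of ℝ[C] is a sum of squares in ℝ[C]. -/
open Polynomial

noncomputable section

/-! ### Archimedean sums of squares in real algebras -/

section Archimedean

variable {A : Type*} [CommRing A]

theorem IsSumSq.sq (a : A) : IsSumSq (a ^ 2) := by
  rw [pow_two]
  exact IsSumSq.mul_self a

theorem IsSumSq.of_eq {a b : A} (ha : IsSumSq a) (h : b = a) : IsSumSq b :=
  h ▸ ha

/-- A subsemiring containing all squares and avoiding `-1` extends to one that is moreover total. -/
theorem Subsemiring.exists_le_total {P₀ : Subsemiring A} (hsq : ∀ a : A, a ^ 2 ∈ P₀)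
    (hneg : (-1 : A) ∉ P₀) :
    ∃ P : Subsemiring A, P₀ ≤ P ∧ (-1 : A) ∉ P ∧ ∀ a : A, a ∈ P ∨ -a ∈ P := by
  obtain ⟨P, hle, hP⟩ := zorn_le_nonempty₀ {P : Subsemiring A | (-1 : A) ∉ P} (by
    intro c hc hchain P hPc
    refine ⟨sSup c, ?_, fun z hz => le_sSup hz⟩
    intro hmem
    rw [Subsemiring.mem_sSup_of_directedOn ⟨P, hPc⟩ hchain.directedOn] at hmem
    obtain ⟨Q, hQ, h⟩ := hmem
    exact hc hQ h) P₀ hneg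
  refine ⟨P, hle, hP.prop, ?_⟩
  have hsqP : ∀ a : A, a ^ 2 ∈ P := fun a => hle (hsq a)
  have key : ∀ a : A, a ∉ P → ∃ s ∈ P, ∃ t ∈ P, (-1 : A) = s + a * t := by
    intro a ha
    by_contra! hcon
    let Q : Subsemiring A :=
      { carrier := {x | ∃ s ∈ P, ∃ t ∈ P, x = s + a * t}
        zero_mem' := ⟨0, P.zero_mem, 0, P.zero_mem, by ring⟩
        one_mem' := ⟨1, P.one_mem, 0, P.zero_mem, by ring⟩
        add_mem' := by
          rintro _ _ ⟨s, hs, t, ht, rfl⟩ ⟨s', hs', t', ht', rfl⟩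
          exact ⟨s + s', P.add_mem hs hs', t + t', P.add_mem ht ht', by ring⟩
        mul_mem' := by
          rintro _ _ ⟨s, hs, t, ht, rfl⟩ ⟨s', hs', t', ht', rfl⟩
          exact ⟨s * s' + a ^ 2 * (t * t'),
            P.add_mem (P.mul_mem hs hs') (P.mul_mem (hsqP a) (P.mul_mem ht ht')),
            s * t' + t * s', P.add_mem (P.mul_mem hs ht') (P.mul_mem ht hs'), by ring⟩ }
    have hQ : (-1 : A) ∉ Q := by
      rintro ⟨s, hs, t, ht, h⟩
      exact hcon s hs t ht h
    have hPQ : P ≤ Q := fun x hx => ⟨x, hx, 0, P.zero_mem, by ring⟩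
    exact ha (hP.le_of_ge hQ hPQ ⟨0, P.zero_mem, 1, P.one_mem, by ring⟩)
  intro a
  by_contra! hcon
  obtain ⟨s, hs, t, ht, h1⟩ := key a hcon.1
  obtain ⟨s', hs', t', ht', h2⟩ := key (-a) hcon.2
  apply hP.prop
  have h : (-1 : A) = s + s' + s * s' + a ^ 2 * (t * t') := by
    have e1 : a * t = -(1 + s) := by linear_combination -h1
    have e2 : -a * t' = -(1 + s') := by linear_combination -h2
    linear_combination (-a * t') * e1 - (1 + s) * e2
  change (-1 : A) ∈ P
  rw [h]
  exact P.add_mem (P.add_mem (P.add_mem hs hs') (P.mul_mem hs hs'))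
    (P.mul_mem (hsqP a) (P.mul_mem ht ht'))

variable [Algebra ℝ A]

theorem isSumSq_algebraMap {r : ℝ} (hr : 0 ≤ r) : IsSumSq (algebraMap ℝ A r) := by
  rw [← Real.mul_self_sqrt hr, map_mul]
  exact IsSumSq.mul_self _

theorem IsSumSq.map_alg_nonneg {a : A} (ha : IsSumSq a) (φ : A →ₐ[ℝ] ℝ) : 0 ≤ φ a := by
  induction ha with
  | zero => simp
  | sq_add b _ ih =>
    rw [map_add, map_mul]
    exact add_nonneg (mul_self_nonneg _) ih

theorem algebraMap_half_mul_two_mul (a : A) : algebraMap ℝ A (1 / 2) * (2 * a) = a := by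
  have h : algebraMap ℝ A (1 / 2) * 2 = 1 := by
    rw [← map_ofNat (algebraMap ℝ A) 2, ← map_mul]
    norm_num
  rw [← mul_assoc, h, one_mul]

/-- `a` is bounded with respect to the cone of sums of squares. -/
def SumSqBounded (a : A) : Prop :=
  ∃ r : ℝ, IsSumSq (algebraMap ℝ A r - a) ∧ IsSumSq (algebraMap ℝ A r + a)

theorem sumSqBounded_algebraMap (r : ℝ) : SumSqBounded (algebraMap ℝ A r) := by
  refine ⟨|r|, ?_, ?_⟩
  · rw [← map_sub]
    exact isSumSq_algebraMap (sub_nonneg.2 (le_abs_self r))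
  · rw [← map_add]
    exact isSumSq_algebraMap (by linarith [neg_abs_le r])

theorem SumSqBounded.add {a b : A} (ha : SumSqBounded a) (hb : SumSqBounded b) :
    SumSqBounded (a + b) := by
  obtain ⟨r, h1, h2⟩ := ha
  obtain ⟨s, h3, h4⟩ := hb
  refine ⟨r + s, ?_, ?_⟩
  · refine IsSumSq.of_eq (h1.add h3) ?_
    rw [map_add]; ring
  · refine IsSumSq.of_eq (h2.add h4) ?_
    rw [map_add]; ring

theorem SumSqBounded.mul {a b : A} (ha : SumSqBounded a) (hb : SumSqBounded b) :
    SumSqBounded (a * b) := by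
  obtain ⟨r, h1, h2⟩ := ha
  obtain ⟨s, h3, h4⟩ := hb
  have hhalf : IsSumSq (algebraMap ℝ A (1 / 2)) := isSumSq_algebraMap (by norm_num)
  refine ⟨r * s, ?_, ?_⟩
  · rw [← algebraMap_half_mul_two_mul (_ - _)]
    refine hhalf.mul ?_
    refine IsSumSq.of_eq ((h2.mul h3).add (h1.mul h4)) ?_
    rw [map_mul]; ring
  · rw [← algebraMap_half_mul_two_mul (_ + _)]
    refine hhalf.mul ?_
    refine IsSumSq.of_eq ((h2.mul h4).add (h1.mul h3)) ?_
    rw [map_mul]; ring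

theorem SumSqBounded.of_sq {a : A} {r : ℝ} (h : IsSumSq (algebraMap ℝ A r - a ^ 2)) :
    SumSqBounded a := by
  have hhalf : IsSumSq (algebraMap ℝ A (1 / 2)) := isSumSq_algebraMap (by norm_num)
  refine ⟨(r + 1) / 2, ?_, ?_⟩
  · rw [← algebraMap_half_mul_two_mul a]
    refine IsSumSq.of_eq (hhalf.mul (h.add (IsSumSq.sq (a - 1)))) ?_
    rw [show (r + 1) / 2 = 1 / 2 * (r + 1) by ring, map_mul, map_add, map_one]; ring
  · rw [← algebraMap_half_mul_two_mul a]
    refine IsSumSq.of_eq (hhalf.mul (h.add (IsSumSq.sq (a + 1)))) ?_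
    rw [show (r + 1) / 2 = 1 / 2 * (r + 1) by ring, map_mul, map_add, map_one]; ring

/-- A total archimedean subsemiring avoiding `-1` is nonnegative under some real character. -/
theorem Subsemiring.exists_algHom_nonneg {P : Subsemiring A} (hsq : ∀ a : A, a ^ 2 ∈ P)
    (hneg : (-1 : A) ∉ P) (htot : ∀ a : A, a ∈ P ∨ -a ∈ P)
    (harch : ∀ a : A, ∃ r : ℝ, algebraMap ℝ A r - a ∈ P) :
    ∃ φ : A →ₐ[ℝ] ℝ, ∀ a ∈ P, 0 ≤ φ a := by
  have hreal : ∀ r : ℝ, 0 ≤ r → algebraMap ℝ A r ∈ P := by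
    intro r hr
    rw [← Real.sq_sqrt hr, map_pow]
    exact hsq _
  have hreal' : ∀ r : ℝ, algebraMap ℝ A r ∈ P → 0 ≤ r := by
    intro r hr
    by_contra! hlt
    apply hneg
    have h := P.mul_mem hr (hreal (-r)⁻¹ (by rw [inv_nonneg]; linarith))
    rw [← map_mul, inv_neg, mul_neg, mul_inv_cancel₀ hlt.ne, map_neg, map_one] at h
    exact h
  let I : Ideal A :=
    { carrier := {a | ∀ ε : ℝ, 0 < ε → algebraMap ℝ A ε + a ∈ P ∧ algebraMap ℝ A ε - a ∈ P}
      zero_mem' := fun ε hε => by simpa using hreal ε hε.le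
      add_mem' := by
        intro a b ha hb ε hε
        obtain ⟨h1, h2⟩ := ha (ε / 2) (by linarith)
        obtain ⟨h3, h4⟩ := hb (ε / 2) (by linarith)
        have e : algebraMap ℝ A ε = algebraMap ℝ A (ε / 2) + algebraMap ℝ A (ε / 2) := by
          rw [← map_add, add_halves]
        constructor
        · convert P.add_mem h1 h3 using 1
          rw [e]; ring
        · convert P.add_mem h2 h4 using 1
          rw [e]; ring
      smul_mem' := by
        intro c a ha
        suffices H : ∀ c ∈ P, ∀ ε : ℝ, 0 < ε →
            algebraMap ℝ A ε + c * a ∈ P ∧ algebraMap ℝ A ε - c * a ∈ P by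
          rcases htot c with hc | hc
          · exact H c hc
          · intro ε hε
            obtain ⟨h1, h2⟩ := H _ hc ε hε
            constructor
            · convert h2 using 1
              rw [smul_eq_mul]; ring
            · convert h1 using 1
              rw [smul_eq_mul]; ring
        intro c hc ε hε
        obtain ⟨r, hr⟩ := harch c
        have hr' : algebraMap ℝ A (|r| + 1) - c ∈ P := by
          convert P.add_mem hr (hreal (|r| + 1 - r) (by linarith [le_abs_self r])) using 1
          rw [map_sub]; ring
        have hpos : 0 < |r| + 1 := by positivity
        obtain ⟨h1, h2⟩ := ha (ε / (|r| + 1)) (by positivity)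
        have hδ : algebraMap ℝ A (ε / (|r| + 1)) ∈ P := hreal _ (by positivity)
        have e : algebraMap ℝ A ε
            = algebraMap ℝ A (ε / (|r| + 1)) * algebraMap ℝ A (|r| + 1) := by
          rw [← map_mul, div_mul_cancel₀ _ hpos.ne']
        constructor
        · convert P.add_mem (P.mul_mem hδ hr') (P.mul_mem hc h1) using 1
          rw [e]; ring
        · convert P.add_mem (P.mul_mem hδ hr') (P.mul_mem hc h2) using 1
          rw [e]; ring }
  have hmemI : ∀ a : A, a ∈ I ↔ ∀ ε : ℝ, 0 < ε →
    algebraMap ℝ A ε + a ∈ P ∧ algebraMap ℝ A ε - a ∈ P := fun a => Iff.rfl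
  have hconst : ∀ r : ℝ, algebraMap ℝ A r ∈ I → r = 0 := by
    intro r hr
    rw [hmemI] at hr
    have h : ∀ ε : ℝ, 0 < ε → 0 ≤ ε + r ∧ 0 ≤ ε - r := by
      intro ε hε
      obtain ⟨h1, h2⟩ := hr ε hε
      rw [← map_add] at h1
      rw [← map_sub] at h2
      exact ⟨hreal' _ h1, hreal' _ h2⟩
    apply le_antisymm
    · exact le_of_forall_pos_le_add fun ε hε => by linarith [(h ε hε).2]
    · exact le_of_forall_pos_le_add fun ε hε => by linarith [(h ε hε).1]
  have happrox : ∀ a : A, ∃ r : ℝ, a - algebraMap ℝ A r ∈ I := by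
    intro a
    let s : Set ℝ := {r | a - algebraMap ℝ A r ∈ P}
    obtain ⟨n, hn⟩ := harch a
    obtain ⟨m, hm⟩ := harch (-a)
    have hne : s.Nonempty := ⟨-m, by
      change a - algebraMap ℝ A (-m) ∈ P
      convert hm using 1
      rw [map_neg]; ring⟩
    have hbdd : BddAbove s := ⟨n, fun r hr => by
      have h := P.add_mem hn hr
      rw [show algebraMap ℝ A n - a + (a - algebraMap ℝ A r) = algebraMap ℝ A (n - r) by
        rw [map_sub]; ring] at h
      linarith [hreal' _ h]⟩
    refine ⟨sSup s, fun ε hε => ⟨?_, ?_⟩⟩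
    · obtain ⟨r, hr, hlt⟩ := exists_lt_of_lt_csSup hne (sub_lt_self (sSup s) hε)
      have hr' : a - algebraMap ℝ A r ∈ P := hr
      convert P.add_mem hr' (hreal (r - (sSup s - ε)) (by linarith)) using 1
      simp only [map_sub]; ring
    · have hnot : sSup s + ε ∉ s := fun h => by linarith [le_csSup hbdd h]
      have h := (htot (a - algebraMap ℝ A (sSup s + ε))).resolve_left hnot
      convert h using 1
      rw [map_add]; ring
  have hbij : Function.Bijective (Algebra.ofId ℝ (A ⧸ I)) := by
    constructor
    · rw [injective_iff_map_eq_zero]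
      intro r hr
      apply hconst
      rw [← Ideal.Quotient.eq_zero_iff_mem]
      exact hr
    · intro x
      obtain ⟨a, rfl⟩ := Ideal.Quotient.mk_surjective x
      obtain ⟨r, hr⟩ := happrox a
      refine ⟨r, ?_⟩
      exact (Ideal.Quotient.eq.2 hr).symm
  let e := AlgEquiv.ofBijective (Algebra.ofId ℝ (A ⧸ I)) hbij
  let φ : A →ₐ[ℝ] ℝ := (e.symm : (A ⧸ I) →ₐ[ℝ] ℝ).comp (Ideal.Quotient.mkₐ ℝ I)
  refine ⟨φ, fun a ha => ?_⟩
  have hφ : a - algebraMap ℝ A (φ a) ∈ I := by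
    rw [← Ideal.Quotient.eq]
    exact (e.apply_symm_apply (Ideal.Quotient.mk I a)).symm
  refine le_of_forall_pos_le_add fun ε hε => hreal' _ ?_
  convert P.add_mem ((hmemI _).1 hφ ε hε).2 ha using 1
  rw [map_add]; ring

/-- If `f` is positive at all real characters of an archimedean real algebra, then some multiple
of `f` by a sum of squares exceeds `1` by a sum of squares. -/
theorem exists_isSumSq_mul_eq_one_add (harch : ∀ a : A, SumSqBounded a) {f : A}
    (hf : ∀ φ : A →ₐ[ℝ] ℝ, 0 < φ f) :
    ∃ s t : A, IsSumSq s ∧ IsSumSq t ∧ t * f = 1 + s := by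
  by_contra! hcon
  let P₀ : Subsemiring A :=
    { carrier := {x | ∃ s t : A, IsSumSq s ∧ IsSumSq t ∧ x = s - t * f}
      zero_mem' := ⟨0, 0, .zero, .zero, by ring⟩
      one_mem' := ⟨1, 0, .one, .zero, by ring⟩
      add_mem' := by
        rintro _ _ ⟨s, t, hs, ht, rfl⟩ ⟨s', t', hs', ht', rfl⟩
        exact ⟨s + s', t + t', hs.add hs', ht.add ht', by ring⟩
      mul_mem' := by
        rintro _ _ ⟨s, t, hs, ht, rfl⟩ ⟨s', t', hs', ht', rfl⟩
        exact ⟨s * s' + f ^ 2 * (t * t'), s * t' + t * s',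
          (hs.mul hs').add ((IsSumSq.sq f).mul (ht.mul ht')),
          (hs.mul ht').add (ht.mul hs'), by ring⟩ }
  have hS : ∀ a : A, IsSumSq a → a ∈ P₀ := fun a ha => ⟨a, 0, ha, .zero, by ring⟩
  have hneg : (-1 : A) ∉ P₀ := by
    rintro ⟨s, t, hs, ht, h⟩
    exact hcon s t hs ht (by linear_combination h)
  obtain ⟨P, hle, hP, htot⟩ := Subsemiring.exists_le_total (fun a => hS _ (IsSumSq.sq a)) hneg
  obtain ⟨φ, hφ⟩ := Subsemiring.exists_algHom_nonneg (fun a => hle (hS _ (IsSumSq.sq a))) hP htot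
    (fun a => (harch a).imp fun r hr => hle (hS _ hr.1))
  have h := hφ (-f) (hle ⟨0, 1, .zero, .one, by ring⟩)
  rw [map_neg] at h
  linarith [hf φ]

/-- In an archimedean real algebra, elements positive at all real characters are bounded below
by a positive constant. -/
theorem exists_pos_le_of_forall_pos (harch : ∀ a : A, SumSqBounded a) {f : A}
    (hf : ∀ φ : A →ₐ[ℝ] ℝ, 0 < φ f) : ∃ δ : ℝ, 0 < δ ∧ ∀ φ : A →ₐ[ℝ] ℝ, δ ≤ φ f := by
  obtain ⟨s, t, hs, ht, h⟩ := exists_isSumSq_mul_eq_one_add harch hf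
  obtain ⟨r, hr, -⟩ := harch t
  refine ⟨1 / (|r| + 1), by positivity, fun φ => ?_⟩
  have h1 : φ t * φ f = 1 + φ s := by rw [← map_mul, h, map_add, map_one]
  have h2 := hs.map_alg_nonneg φ
  have h3 := hr.map_alg_nonneg φ
  rw [map_sub, AlgHom.commutes, Algebra.algebraMap_self, RingHom.id_apply] at h3
  rw [div_le_iff₀ (by positivity)]
  nlinarith [hf φ, le_abs_self r]

/-- Positivstellensatz: in an archimedean real algebra, an element that is positive at all real
characters is a sum of squares. -/
theorem isSumSq_of_forall_pos (harch : ∀ a : A, SumSqBounded a) {f : A}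
    (hf : ∀ φ : A →ₐ[ℝ] ℝ, 0 < φ f) : IsSumSq f := by
  obtain ⟨s, t, hs, ht, h⟩ := exists_isSumSq_mul_eq_one_add harch hf
  obtain ⟨r₀, hr₀, -⟩ := harch t
  obtain ⟨N, hNpos, hN⟩ : ∃ N : ℝ, 0 < N ∧ IsSumSq (algebraMap ℝ A N - t) := by
    refine ⟨|r₀| + 1, by positivity, ?_⟩
    refine IsSumSq.of_eq (hr₀.add (isSumSq_algebraMap (A := A) (r := |r₀| + 1 - r₀)
      (by linarith [le_abs_self r₀]))) ?_
    rw [map_sub]; ring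
  have step : ∀ r : ℝ, 0 ≤ r → IsSumSq (algebraMap ℝ A r + f) →
      IsSumSq (algebraMap ℝ A (r - 1 / N) + f) := by
    intro r hr hrf
    have h1 : IsSumSq (algebraMap ℝ A N⁻¹) := isSumSq_algebraMap (by positivity)
    have h2 := h1.mul (((hN.mul hrf).add hs).add (ht.mul (isSumSq_algebraMap (A := A) hr)))
    refine IsSumSq.of_eq h2 ?_
    have e : algebraMap ℝ A N⁻¹ * algebraMap ℝ A N = 1 := by
      rw [← map_mul, inv_mul_cancel₀ hNpos.ne', map_one]
    rw [map_sub, one_div]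
    linear_combination (-(algebraMap ℝ A r) - f) * e + algebraMap ℝ A N⁻¹ * h
  obtain ⟨r₁, -, hr₁⟩ := harch f
  have hdown : ∀ n : ℕ, IsSumSq f ∨ IsSumSq (algebraMap ℝ A (|r₁| - n / N) + f) := by
    intro n
    induction n with
    | zero =>
      right
      refine IsSumSq.of_eq (hr₁.add (isSumSq_algebraMap (A := A) (r := |r₁| - r₁)
        (by linarith [le_abs_self r₁]))) ?_
      rw [map_sub]; simp; ring
    | succ n ih =>
      rcases ih with ih | ih
      · exact Or.inl ih
      · rcases le_total 0 (|r₁| - n / N) with h0 | h0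
        · right
          convert step _ h0 ih using 3
          push_cast; ring
        · left
          refine IsSumSq.of_eq (ih.add (isSumSq_algebraMap (A := A) (neg_nonneg.2 h0))) ?_
          rw [map_neg]; ring
  obtain ⟨n, hn⟩ := exists_nat_ge (|r₁| * N)
  rcases hdown n with h1 | h1
  · exact h1
  · have h0 : |r₁| - n / N ≤ 0 := by
      rw [sub_nonpos, le_div_iff₀ hNpos]
      exact hn
    refine IsSumSq.of_eq (h1.add (isSumSq_algebraMap (A := A) (neg_nonneg.2 h0))) ?_
    rw [map_neg]; ring

/-- Local-global principle for sums of squares in an archimedean real algebra: `f` is a sum of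
squares as soon as every maximal ideal avoids some nonnegative `t` such that `t * f` is one. -/
theorem isSumSq_of_forall_isMaximal (harch : ∀ a : A, SumSqBounded a) {f : A}
    (hloc : ∀ m : Ideal A, m.IsMaximal →
      ∃ t ∉ m, (∀ φ : A →ₐ[ℝ] ℝ, 0 ≤ φ t) ∧ IsSumSq (t * f)) : IsSumSq f := by
  let T : Set A := {t | (∀ φ : A →ₐ[ℝ] ℝ, 0 ≤ φ t) ∧ IsSumSq (t * f)}
  have htop : Ideal.span T = ⊤ := by
    by_contra hne
    obtain ⟨m, hm, hle⟩ := Ideal.exists_le_maximal _ hne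
    obtain ⟨t, htm, ht⟩ := hloc m hm
    exact htm (hle (Ideal.subset_span ht))
  have hone : (1 : A) ∈ Submodule.span A T := by
    change (1 : A) ∈ Ideal.span T
    rw [htop]; trivial
  obtain ⟨n, k, g, hkg⟩ := Submodule.mem_span_set'.1 hone
  simp only [smul_eq_mul] at hkg
  let t : A := ∑ i, (g i : A)
  have hg : ∀ i (φ : A →ₐ[ℝ] ℝ), 0 ≤ φ (g i) := fun i φ => (g i).2.1 φ
  have htpos : ∀ φ : A →ₐ[ℝ] ℝ, 0 < φ t := by
    intro φ
    have hnn : 0 ≤ φ t := by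
      rw [map_sum]
      exact Finset.sum_nonneg fun i _ => hg i φ
    refine lt_of_le_of_ne hnn fun h0 => ?_
    rw [map_sum, eq_comm, Finset.sum_eq_zero_iff_of_nonneg fun i _ => hg i φ] at h0
    have h1 := congrArg φ hkg
    rw [map_sum, map_one, Finset.sum_eq_zero] at h1
    · exact zero_ne_one h1
    · intro i hi
      rw [map_mul, h0 i hi, mul_zero]
  obtain ⟨δ, hδ, hδt⟩ := exists_pos_le_of_forall_pos harch htpos
  obtain ⟨M₀, hM₀, -⟩ := harch t
  choose R hR₁ hR₂ using fun i => harch (k i)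
  set M : ℝ := |M₀| + δ + 1 with hMdef
  have hMpos : 0 < M := by positivity
  have htM : ∀ φ : A →ₐ[ℝ] ℝ, φ t ≤ M := by
    intro φ
    have h := hM₀.map_alg_nonneg φ
    rw [map_sub, AlgHom.commutes, Algebra.algebraMap_self, RingHom.id_apply] at h
    linarith [le_abs_self M₀]
  set ρ : ℝ := 1 - δ / M with hρdef
  have hδM : δ / M ≤ 1 := by
    rw [div_le_one hMpos]
    linarith [abs_nonneg M₀]
  have hρ0 : 0 ≤ ρ := by linarith
  have hρ1 : ρ < 1 := by
    have : 0 < δ / M := by positivity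
    linarith
  set K : ℝ := ∑ i, |R i| + 1 with hKdef
  have hKpos : 0 < K := by positivity
  have hkK : ∀ i (φ : A →ₐ[ℝ] ℝ), -K ≤ φ (k i) := by
    intro i φ
    have h := (hR₂ i).map_alg_nonneg φ
    rw [map_add, AlgHom.commutes, Algebra.algebraMap_self, RingHom.id_apply] at h
    have h2 : |R i| ≤ ∑ i, |R i| :=
      Finset.single_le_sum (f := fun i => |R i|) (fun j _ => abs_nonneg _) (Finset.mem_univ i)
    linarith [le_abs_self (R i)]
  obtain ⟨N, hN⟩ := exists_pow_lt_of_lt_one (show 0 < 1 / M / K by positivity) hρ1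
  let z : A := 1 - algebraMap ℝ A M⁻¹ * t
  let a : A := algebraMap ℝ A M⁻¹ * ∑ j ∈ Finset.range (N + 1), z ^ j
  have hat : 1 - a * t = z ^ (N + 1) := by
    have := mul_neg_geom_sum z (N + 1)
    have hz : 1 - z = algebraMap ℝ A M⁻¹ * t := by simp only [z]; ring
    rw [hz] at this
    simp only [a]
    linear_combination -this
  have hzφ : ∀ φ : A →ₐ[ℝ] ℝ, 0 ≤ φ z ∧ φ z ≤ ρ := by
    intro φ
    have e : φ z = 1 - φ t / M := by
      simp only [z]
      rw [map_sub, map_one, map_mul, AlgHom.commutes, Algebra.algebraMap_self, RingHom.id_apply]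
      ring
    rw [e]
    constructor
    · rw [sub_nonneg, div_le_one hMpos]
      exact htM φ
    · have := div_le_div_of_nonneg_right (hδt φ) hMpos.le
      linarith
  have haφ : ∀ φ : A →ₐ[ℝ] ℝ, 1 / M ≤ φ a := by
    intro φ
    simp only [a]
    rw [map_mul, AlgHom.commutes, Algebra.algebraMap_self, RingHom.id_apply, map_sum,
      Finset.sum_range_succ']
    simp only [map_pow, pow_zero, map_one]
    have h := Finset.sum_nonneg fun j (_ : j ∈ Finset.range N) =>
      pow_nonneg (hzφ φ).1 (j + 1)
    rw [one_div]
    have hMi : 0 < M⁻¹ := by positivity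
    nlinarith
  have hβ : ∀ i, IsSumSq (a + k i * (1 - a * t)) := by
    intro i
    refine isSumSq_of_forall_pos harch fun φ => ?_
    rw [hat, map_add, map_mul φ (k i), map_pow]
    have h1 : φ z ^ (N + 1) ≤ ρ ^ N :=
      (pow_le_pow_left₀ (hzφ φ).1 (hzφ φ).2 _).trans
        (pow_le_pow_of_le_one hρ0 hρ1.le (Nat.le_succ N))
    have h2 : 0 ≤ φ z ^ (N + 1) := pow_nonneg (hzφ φ).1 _
    rw [lt_div_iff₀ hKpos] at hN
    nlinarith [hkK i φ, haφ φ]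
  have hfin : f = ∑ i, (a + k i * (1 - a * t)) * ((g i : A) * f) := by
    have e : ∀ i, (a + k i * (1 - a * t)) * ((g i : A) * f)
        = (a * f) * (g i : A) + ((1 - a * t) * f) * (k i * (g i : A)) := fun i => by ring
    simp only [e, Finset.sum_add_distrib, ← Finset.mul_sum, hkg]
    change f = a * f * t + _
    ring
  rw [hfin]
  exact IsSumSq.sum fun i _ => (hβ i).mul (g i).2.2

end Archimedean

/-! ### Univariate real polynomials -/

open Filter Topology

theorem exists_linear_or_quadratic_dvd {p : ℝ[X]} (hp : p.natDegree ≠ 0) :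
    (∃ u : ℝ, X - C u ∣ p) ∨ ∃ α β : ℝ, β ≠ 0 ∧ (X - C α) ^ 2 + C (β ^ 2) ∣ p := by
  obtain ⟨z, hz⟩ := IsAlgClosed.exists_aeval_eq_zero ℂ p
    (fun h => hp (natDegree_eq_of_degree_eq_some h))
  by_cases him : z.im = 0
  · left
    refine ⟨z.re, ?_⟩
    rw [dvd_iff_isRoot, IsRoot]
    have hre : z = algebraMap ℝ ℂ z.re := Complex.ext (by simp) (by simp [him])
    rw [hre, aeval_algebraMap_apply] at hz
    simpa using hz
  · right
    refine ⟨z.re, z.im, him, ?_⟩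
    convert Polynomial.quadratic_dvd_of_aeval_eq_zero_im_ne_zero p hz him using 1
    rw [← Complex.normSq_eq_norm_sq, Complex.normSq_apply]
    simp only [map_mul, map_add, map_pow, map_ofNat]
    ring

theorem Polynomial.eventually_eval_ne_zero {p : ℝ[X]} (hp : p ≠ 0) (u : ℝ) :
    ∀ᶠ x in 𝓝[≠] u, p.eval x ≠ 0 := by
  have hfin : {x | p.eval x = 0}.Finite := by
    refine (p.roots.toFinset.finite_toSet).subset fun x hx => ?_
    simpa [hp] using hx
  have h : ({x | p.eval x = 0} \ {u})ᶜ ∈ 𝓝 u :=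
    (hfin.subset Set.sdiff_subset).isClosed.isOpen_compl.mem_nhds (by simp)
  filter_upwards [mem_nhdsWithin_of_mem_nhds h, self_mem_nhdsWithin] with x hx hxu h0
  exact hx ⟨h0, hxu⟩

theorem Polynomial.eval_nonneg_of_off_zeros {p g : ℝ[X]} (hp : p ≠ 0)
    (h : ∀ x, p.eval x ≠ 0 → 0 ≤ g.eval x) (x : ℝ) : 0 ≤ g.eval x :=
  ge_of_tendsto (g.continuous.continuousAt.tendsto.mono_left nhdsWithin_le_nhds)
    ((p.eventually_eval_ne_zero hp x).mono fun y hy => h y hy)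

theorem Polynomial.eval_eq_zero_of_sub_mul_nonneg {g : ℝ[X]} {u : ℝ}
    (h : ∀ᶠ x in 𝓝 u, 0 ≤ (x - u) * g.eval x) : g.eval u = 0 := by
  have hlim : ∀ s : Set ℝ, Tendsto (fun x => g.eval x) (𝓝[s] u) (𝓝 (g.eval u)) :=
    fun s => g.continuous.continuousAt.tendsto.mono_left nhdsWithin_le_nhds
  apply le_antisymm
  · refine le_of_tendsto (hlim (Set.Iio u)) ?_
    filter_upwards [mem_nhdsWithin_of_mem_nhds h, self_mem_nhdsWithin] with x hx hxu
    have hxu' : x < u := hxu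
    nlinarith
  · refine ge_of_tendsto (hlim (Set.Ioi u)) ?_
    filter_upwards [mem_nhdsWithin_of_mem_nhds h, self_mem_nhdsWithin] with x hx hxu
    have hxu' : u < x := hxu
    exact nonneg_of_mul_nonneg_right hx (sub_pos.2 hxu')

theorem natDegree_X_sub_C_sq_add_C (α r : ℝ) : ((X - C α) ^ 2 + C r).natDegree = 2 := by
  rw [natDegree_add_C, natDegree_pow, natDegree_X_sub_C]

theorem Polynomial.natDegree_lt_natDegree_mul {d g : ℝ[X]} (hd : d.natDegree ≠ 0) (hg : g ≠ 0) :
    g.natDegree < (d * g).natDegree := by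
  rw [natDegree_mul (fun h => hd (by simp [h])) hg]
  lia

/-- A nonnegative univariate real polynomial is a sum of squares. -/
theorem Polynomial.isSumSq_of_eval_nonneg {p : ℝ[X]} (hp : ∀ x, 0 ≤ p.eval x) : IsSumSq p := by
  induction hn : p.natDegree using Nat.strong_induction_on generalizing p with
  | _ n ih =>
  subst hn
  by_cases hp0 : p.natDegree = 0
  · rw [eq_C_of_natDegree_eq_zero hp0] at hp ⊢
    exact isSumSq_algebraMap (A := ℝ[X]) (by simpa using hp 0)
  rcases exists_linear_or_quadratic_dvd hp0 with ⟨u, g, rfl⟩ | ⟨α, β, hβ, g, rfl⟩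
  · have hg : g.eval u = 0 :=
      eval_eq_zero_of_sub_mul_nonneg (Eventually.of_forall fun x => by simpa using hp x)
    obtain ⟨h, rfl⟩ := dvd_iff_isRoot.2 hg
    have hh0 : (X - C u) * h ≠ 0 := fun h0 => hp0 (by simp [h0])
    have hX : (X - C u : ℝ[X]) ≠ 0 := X_sub_C_ne_zero u
    have hd : (X - C u : ℝ[X]).natDegree ≠ 0 := by simp
    rw [← mul_assoc, ← pow_two]
    refine (IsSumSq.sq _).mul (ih _ ?_ ?_ rfl)
    · exact (natDegree_lt_natDegree_mul hd (right_ne_zero_of_mul hh0)).trans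
        (natDegree_lt_natDegree_mul hd hh0)
    · refine eval_nonneg_of_off_zeros hX fun x hx => ?_
      have := hp x
      rw [eval_mul, eval_mul, ← mul_assoc] at this
      exact nonneg_of_mul_nonneg_right this (mul_self_pos.2 hx)
  · have hg0 : g ≠ 0 := fun h0 => hp0 (by simp [h0])
    refine IsSumSq.mul ((IsSumSq.sq _).add ?_) (ih _ ?_ ?_ rfl)
    · rw [map_pow]
      exact IsSumSq.sq _
    · exact natDegree_lt_natDegree_mul (by rw [natDegree_X_sub_C_sq_add_C]; norm_num) hg0
    · intro x
      have := hp x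
      rw [eval_mul] at this
      refine nonneg_of_mul_nonneg_right this ?_
      simp only [eval_add, eval_pow, eval_sub, eval_X, eval_C]
      positivity

/-- A nonzero prime ideal of `ℝ[X]` is generated by a real linear polynomial or by a positive
quadratic polynomial. -/
theorem Ideal.IsPrime.exists_generator {P : Ideal ℝ[X]} (hP : P.IsPrime) {N : ℝ[X]} (hN : N ≠ 0)
    (hNP : N ∈ P) :
    ∃ p : ℝ[X], Irreducible p ∧ (∀ g, g ∈ P ↔ p ∣ g) ∧
      ((∃ u : ℝ, p = X - C u) ∨ ∃ α β : ℝ, β ≠ 0 ∧ p = (X - C α) ^ 2 + C (β ^ 2)) := by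
  have hbot : P ≠ ⊥ := fun h => hN (by simpa [h] using hNP)
  obtain ⟨r, hrP⟩ := (IsPrincipalIdealRing.principal P).principal
  have hPr : P = Ideal.span {r} := hrP
  have hr0 : r ≠ 0 := fun h => hbot (by rw [hPr, h, Ideal.span_singleton_eq_bot])
  have hrprime : Prime r := (Ideal.span_singleton_prime hr0).1 (hPr ▸ hP)
  have hrirr := hrprime.irreducible
  have hdeg : r.natDegree ≠ 0 := hrirr.natDegree_pos.ne'
  have key : ∀ p : ℝ[X], p.natDegree ≠ 0 → p ∣ r →
      Irreducible p ∧ (∀ g, g ∈ P ↔ p ∣ g) := by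
    intro p hp hpr
    have hass : Associated r p := hrirr.dvd_iff.1 hpr |>.resolve_left fun hu =>
      hp (natDegree_eq_zero_of_isUnit hu)
    refine ⟨hass.irreducible hrirr, fun g => ?_⟩
    rw [hPr, Ideal.mem_span_singleton]
    exact hass.dvd_iff_dvd_left
  rcases exists_linear_or_quadratic_dvd hdeg with ⟨u, h⟩ | ⟨α, β, hβ, h⟩
  · obtain ⟨h1, h2⟩ := key _ (by simp) h
    exact ⟨_, h1, h2, Or.inl ⟨u, rfl⟩⟩
  · obtain ⟨h1, h2⟩ := key _ (by rw [natDegree_X_sub_C_sq_add_C]; norm_num) h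
    exact ⟨_, h1, h2, Or.inr ⟨α, β, hβ, rfl⟩⟩


/-! ### The coordinate ring of the curve -/

section Curve

variable {q : ℝ[X]}

/-- The element `a(x) + b(x)·y` of the coordinate ring. -/
def curveElem (q a b : ℝ[X]) : CurveRing q :=
  AdjoinRoot.of (curvePoly q) a + AdjoinRoot.of (curvePoly q) b * AdjoinRoot.root (curvePoly q)

theorem curve_root_sq (q : ℝ[X]) :
    AdjoinRoot.root (curvePoly q) ^ 2 = -AdjoinRoot.of (curvePoly q) q := by
  have h : AdjoinRoot.mk (curvePoly q) (X ^ 2 + C q) = 0 := AdjoinRoot.mk_self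
  rw [map_add, map_pow, AdjoinRoot.mk_X, AdjoinRoot.mk_C] at h
  exact eq_neg_of_add_eq_zero_left h

theorem curve_algebraMap (q : ℝ[X]) (r : ℝ) :
    algebraMap ℝ (CurveRing q) r = AdjoinRoot.of (curvePoly q) (C r) := rfl

theorem curveElem_rep (f : CurveRing q) : curveElem q (repA q f) (repB q f) = f := by
  have hdeg : (curveRep q f).degree < 2 := by
    obtain ⟨p, rfl⟩ := AdjoinRoot.mk_surjective f
    rw [curveRep, AdjoinRoot.modByMonicHom_mk]
    refine (degree_modByMonic_lt _ (curvePoly_monic q)).trans_eq ?_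
    rw [curvePoly, degree_X_pow_add_C (by norm_num)]
    rfl
  have hrep : AdjoinRoot.mk (curvePoly q) (curveRep q f) = f :=
    AdjoinRoot.mk_leftInverse (curvePoly_monic q) f
  conv_rhs => rw [← hrep, eq_X_add_C_of_degree_le_one (Order.le_of_lt_succ hdeg)]
  rw [map_add, map_mul, AdjoinRoot.mk_X, AdjoinRoot.mk_C, AdjoinRoot.mk_C, curveElem, repA, repB]
  ring

theorem algHom_of (φ : CurveRing q →ₐ[ℝ] ℝ) (p : ℝ[X]) :
    φ (AdjoinRoot.of (curvePoly q) p) = p.eval (φ (AdjoinRoot.of (curvePoly q) X)) := by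
  have h : (φ : CurveRing q →+* ℝ).comp (AdjoinRoot.of (curvePoly q))
      = evalRingHom (φ (AdjoinRoot.of (curvePoly q) X)) := by
    ext r
    · simp only [RingHom.comp_apply, RingHom.coe_coe, coe_evalRingHom, eval_C]
      exact φ.commutes r
    · simp
  exact RingHom.congr_fun h p

theorem algHom_root (φ : CurveRing q →ₐ[ℝ] ℝ) :
    φ (AdjoinRoot.root (curvePoly q)) ^ 2 + q.eval (φ (AdjoinRoot.of (curvePoly q) X)) = 0 := by
  rw [← algHom_of, ← map_pow, curve_root_sq, map_neg, neg_add_cancel]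

theorem exists_algHom {u v : ℝ} (h : v ^ 2 + q.eval u = 0) :
    ∃ φ : CurveRing q →ₐ[ℝ] ℝ, φ (AdjoinRoot.of (curvePoly q) X) = u ∧
      φ (AdjoinRoot.root (curvePoly q)) = v := by
  have h' : (curvePoly q).eval₂ (evalRingHom u) v = 0 := by
    simpa [curvePoly] using h
  refine ⟨{ AdjoinRoot.lift (evalRingHom u) v h' with commutes' := fun r => ?_ }, ?_, ?_⟩
  · change AdjoinRoot.lift (evalRingHom u) v h' (AdjoinRoot.of _ (C r)) = r
    simp
  · change AdjoinRoot.lift (evalRingHom u) v h' (AdjoinRoot.of _ X) = u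
    simp
  · change AdjoinRoot.lift (evalRingHom u) v h' (AdjoinRoot.root _) = v
    simp

theorem IsSumSq.map_ringHom {R S : Type*} [CommRing R] [CommRing S] (f : R →+* S) {a : R}
    (ha : IsSumSq a) : IsSumSq (f a) := by
  induction ha with
  | zero => rw [map_zero]; exact .zero
  | sq_add b _ ih => rw [map_add, map_mul]; exact .sq_add _ ih

theorem sumSqBounded_curveRing (hmonic : q.Monic) (hdeg : q.natDegree = 4) (f : CurveRing q) :
    SumSqBounded f := by
  obtain ⟨K, hK⟩ : ∃ K : ℝ, ∀ x, 0 ≤ q.eval x - x ^ 2 + K := by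
    have h4 : q.coeff 4 = 1 := by rw [← hdeg]; exact hmonic
    refine ⟨(q.coeff 3 ^ 2 / 2 + 3 / 2 - q.coeff 2) ^ 2 / 2 + q.coeff 1 ^ 2 / 2 - q.coeff 0,
      fun x => ?_⟩
    rw [eval_eq_sum_range, hdeg]
    simp only [Finset.sum_range_succ, Finset.sum_range_zero, h4]
    nlinarith [sq_nonneg (x ^ 2 + q.coeff 3 * x), sq_nonneg (x + q.coeff 1),
      sq_nonneg (x ^ 2 - (q.coeff 3 ^ 2 / 2 + 3 / 2 - q.coeff 2))]
  have hx : SumSqBounded (AdjoinRoot.of (curvePoly q) X) := by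
    refine SumSqBounded.of_sq (r := K) ?_
    have h : IsSumSq (q - X ^ 2 + C K) := isSumSq_of_eval_nonneg fun x => by simpa using hK x
    refine ((h.map_ringHom (AdjoinRoot.of (curvePoly q))).add
      (IsSumSq.sq (AdjoinRoot.root (curvePoly q)))).of_eq ?_
    rw [curve_root_sq, curve_algebraMap, map_add, map_sub, map_pow]
    ring
  have hy : SumSqBounded (AdjoinRoot.root (curvePoly q)) := by
    refine SumSqBounded.of_sq (r := K) ?_
    have h : IsSumSq (q + C K) := isSumSq_of_eval_nonneg fun x => by
      have := hK x
      simp only [eval_add, eval_C]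
      nlinarith
    refine (h.map_ringHom (AdjoinRoot.of (curvePoly q))).of_eq ?_
    rw [curve_root_sq, curve_algebraMap, map_add]
    ring
  have hpoly : ∀ p : ℝ[X], SumSqBounded (AdjoinRoot.of (curvePoly q) p) := by
    intro p
    induction p using Polynomial.induction_on' with
    | add p r hp hr => rw [map_add]; exact hp.add hr
    | monomial n c =>
      rw [← C_mul_X_pow_eq_monomial]
      induction n with
      | zero => rw [pow_zero, mul_one, ← curve_algebraMap]; exact sumSqBounded_algebraMap c
      | succ n ih => rw [pow_succ, ← mul_assoc, map_mul]; exact ih.mul hx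
  rw [← curveElem_rep f]
  exact (hpoly _).add ((hpoly _).mul hy)

theorem not_dvd_of_squarefree {q p r : ℝ[X]} (hq : Squarefree q) (hp : Irreducible p)
    (h : q = p * r) : ¬p ∣ r := by
  rintro ⟨s, rfl⟩
  exact hp.not_isUnit (hq p ⟨s, by rw [h, mul_assoc]⟩)

/-- Real points of the curve are not isolated, so nonnegativity may be tested away from the
zeros of a nonzero polynomial in `x`. -/
theorem algHom_nonneg_of_off_zeros (hq : Squarefree q) {N : ℝ[X]} (hN : N ≠ 0) {t : CurveRing q}
    (h : ∀ φ : CurveRing q →ₐ[ℝ] ℝ, N.eval (φ (AdjoinRoot.of (curvePoly q) X)) ≠ 0 → 0 ≤ φ t)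
    (φ : CurveRing q →ₐ[ℝ] ℝ) : 0 ≤ φ t := by
  obtain ⟨a, b, rfl⟩ : ∃ a b, t = curveElem q a b := ⟨_, _, (curveElem_rep t).symm⟩
  have hφ := algHom_root φ
  set u := φ (AdjoinRoot.of (curvePoly q) X) with hu
  set v := φ (AdjoinRoot.root (curvePoly q)) with hv
  have hfreq : ∃ᶠ x in 𝓝[≠] u, q.eval x ≤ 0 := by
    by_contra hcon
    rw [not_frequently] at hcon
    simp only [not_le] at hcon
    have hqu : q.eval u = 0 := by
      apply le_antisymm
      · nlinarith
      · exact ge_of_tendsto (q.continuous.continuousAt.tendsto.mono_left nhdsWithin_le_nhds)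
          (hcon.mono fun x hx => hx.le)
    obtain ⟨r, hr⟩ := dvd_iff_isRoot.2 hqu
    refine not_dvd_of_squarefree hq (irreducible_X_sub_C u) hr (dvd_iff_isRoot.2 ?_)
    apply eval_eq_zero_of_sub_mul_nonneg
    filter_upwards [eventually_nhdsWithin_iff.1 hcon] with x hx
    by_cases hxu : x = u
    · simp [hxu]
    · have := hx hxu
      rw [hr] at this
      simpa using this.le
  obtain ⟨s, hs, hsv⟩ : ∃ s : ℝ, s ^ 2 = 1 ∧ v = s * √(-q.eval u) := by
    have e : √(-q.eval u) = |v| := by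
      rw [← Real.sqrt_sq_eq_abs]
      congr 1
      linarith
    rw [e]
    rcases le_total 0 v with h0 | h0
    · exact ⟨1, by norm_num, by rw [abs_of_nonneg h0, one_mul]⟩
    · exact ⟨-1, by norm_num, by rw [abs_of_nonpos h0]; ring⟩
  have hval : φ (curveElem q a b) = a.eval u + b.eval u * (s * √(-q.eval u)) := by
    rw [curveElem, map_add, map_mul, algHom_of φ a, algHom_of φ b, ← hsv]
  rw [hval]
  have hcont : Continuous fun x => a.eval x + b.eval x * (s * √(-q.eval x)) := by
    have := a.continuous
    have := b.continuous
    have := q.continuous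
    fun_prop
  refine ge_of_tendsto_of_frequently
    (hcont.continuousAt.tendsto.mono_left (nhdsWithin_le_nhds (s := {u}ᶜ))) ?_
  refine (hfreq.and_eventually (eventually_eval_ne_zero hN u)).mono fun x hx => ?_
  obtain ⟨ψ, hψx, hψy⟩ := exists_algHom (q := q) (u := x) (v := s * √(-q.eval x)) (by
    rw [mul_pow, hs, Real.sq_sqrt (by linarith [hx.1])]; ring)
  have := h ψ (by rw [hψx]; exact hx.2)
  rwa [curveElem, map_add, map_mul, algHom_of ψ a, algHom_of ψ b, hψx, hψy] at this

theorem curveElem_mul_conj (a b : ℝ[X]) :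
    curveElem q a b * curveElem q a (-b) = AdjoinRoot.of (curvePoly q) (a ^ 2 + q * b ^ 2) := by
  simp only [curveElem, map_neg, map_add, map_mul, map_pow]
  linear_combination (-(AdjoinRoot.of (curvePoly q) b) ^ 2) * curve_root_sq q

theorem curveElem_mul_left (d a b : ℝ[X]) :
    curveElem q (d * a) (d * b) = AdjoinRoot.of (curvePoly q) d * curveElem q a b := by
  simp only [curveElem, map_mul]
  ring

/-- An element of norm zero is zero. -/
theorem eq_zero_of_norm_eq_zero (hmonic : q.Monic) {a b : ℝ[X]} (h : a ^ 2 + q * b ^ 2 = 0) :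
    a = 0 ∧ b = 0 := by
  have h1 := congrArg leadingCoeff (eq_neg_of_add_eq_zero_left h)
  rw [leadingCoeff_neg, leadingCoeff_mul, leadingCoeff_pow, leadingCoeff_pow, hmonic.leadingCoeff,
    one_mul] at h1
  exact ⟨leadingCoeff_eq_zero.1 (by nlinarith [sq_nonneg a.leadingCoeff, sq_nonneg b.leadingCoeff]),
    leadingCoeff_eq_zero.1 (by nlinarith [sq_nonneg a.leadingCoeff, sq_nonneg b.leadingCoeff])⟩

theorem abs_mul_sqrt_le_of_psd {a b : ℝ[X]}
    (hf : ∀ φ : CurveRing q →ₐ[ℝ] ℝ, 0 ≤ φ (curveElem q a b)) {x : ℝ} (hx : q.eval x ≤ 0) :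
    |b.eval x * √(-q.eval x)| ≤ a.eval x := by
  have key : ∀ v : ℝ, v ^ 2 + q.eval x = 0 → 0 ≤ a.eval x + b.eval x * v := by
    intro v hv
    obtain ⟨φ, h1, h2⟩ := exists_algHom hv
    simpa only [curveElem, map_add, map_mul, algHom_of, h1, h2] using hf φ
  have hs : √(-q.eval x) ^ 2 = -q.eval x := Real.sq_sqrt (by linarith)
  have h1 := key (√(-q.eval x)) (by linarith)
  have h2 := key (-√(-q.eval x)) (by rw [neg_sq]; linarith)
  rw [abs_le]
  constructor <;> linarith

theorem norm_nonneg_of_psd {a b : ℝ[X]}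
    (hf : ∀ φ : CurveRing q →ₐ[ℝ] ℝ, 0 ≤ φ (curveElem q a b)) (x : ℝ) :
    0 ≤ (a ^ 2 + q * b ^ 2).eval x := by
  simp only [eval_add, eval_mul, eval_pow]
  rcases le_total 0 (q.eval x) with hx | hx
  · positivity
  · have h := abs_mul_sqrt_le_of_psd hf hx
    have h2 := pow_le_pow_left₀ (abs_nonneg _) h 2
    rw [sq_abs, mul_pow, Real.sq_sqrt (by linarith)] at h2
    linarith

/-- If a psd element is divisible by `x - u` and the norm of the quotient vanishes at `u`, then
the quotient is divisible by `x - u` as well. -/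
theorem eval_eq_zero_of_psd_of_norm (hq : Squarefree q) {a b : ℝ[X]} {u : ℝ}
    (hf : ∀ φ : CurveRing q →ₐ[ℝ] ℝ, 0 ≤ φ (curveElem q ((X - C u) * a) ((X - C u) * b)))
    (hN : (a ^ 2 + q * b ^ 2).eval u = 0 ∨ q.eval u < 0) : a.eval u = 0 ∧ b.eval u = 0 := by
  have hnn : ∀ x, 0 ≤ (a ^ 2 + q * b ^ 2).eval x := by
    refine eval_nonneg_of_off_zeros (X_sub_C_ne_zero u) fun x hx => ?_
    have h := norm_nonneg_of_psd hf x
    rw [show ((X - C u) * a) ^ 2 + q * ((X - C u) * b) ^ 2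
      = (X - C u) ^ 2 * (a ^ 2 + q * b ^ 2) by ring, eval_mul, eval_pow] at h
    exact nonneg_of_mul_nonneg_right h (by positivity)
  have hnu := hnn u
  simp only [eval_add, eval_mul, eval_pow] at hN hnu
  rcases lt_trichotomy (q.eval u) 0 with hu | hu | hu
  · have ha : a.eval u = 0 := by
      apply eval_eq_zero_of_sub_mul_nonneg
      filter_upwards [q.continuous.continuousAt.eventually_lt_const hu] with x hx
      have h := (abs_nonneg _).trans (abs_mul_sqrt_le_of_psd hf hx.le)
      simpa using h
    refine ⟨ha, ?_⟩
    rw [ha] at hnu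
    by_contra hb
    have : 0 < b.eval u ^ 2 := by positivity
    nlinarith
  · have hN' := hN.resolve_right hu.not_lt
    have ha : a.eval u = 0 := by
      rw [hu] at hN'
      simpa using hN'
    refine ⟨ha, ?_⟩
    obtain ⟨r, hr⟩ := dvd_iff_isRoot.2 hu
    obtain ⟨s, rfl⟩ := dvd_iff_isRoot.2 ha
    have h0 : ((X - C u) * s ^ 2 + r * b ^ 2).eval u = 0 := by
      refine eval_eq_zero_of_sub_mul_nonneg (Eventually.of_forall fun x => ?_)
      convert hnn x using 1
      rw [hr]
      simp only [eval_add, eval_mul, eval_pow, eval_sub, eval_X, eval_C]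
      ring
    have hru : r.eval u ≠ 0 := fun h =>
      not_dvd_of_squarefree hq (irreducible_X_sub_C u) hr (dvd_iff_isRoot.2 h)
    simpa [hru] using h0
  · have hN' := hN.resolve_right hu.not_gt
    have h1 : a.eval u ^ 2 = 0 := by nlinarith [sq_nonneg (a.eval u), sq_nonneg (b.eval u)]
    have h2 : b.eval u ^ 2 = 0 := by nlinarith [sq_nonneg (a.eval u), sq_nonneg (b.eval u)]
    exact ⟨pow_eq_zero_iff two_ne_zero |>.1 h1, pow_eq_zero_iff two_ne_zero |>.1 h2⟩

/-- If `q u ≥ 0`, some `g² - q` has a simple zero at `u`. -/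
theorem exists_sq_sub_simple_zero (hq : Squarefree q) {u : ℝ} (hu : 0 ≤ q.eval u) :
    ∃ g r : ℝ[X], g ^ 2 - q = (X - C u) * r ∧ r.eval u ≠ 0 := by
  obtain ⟨r, hr⟩ : X - C u ∣ q - C (q.eval u) := dvd_iff_isRoot.2 (by simp)
  rcases hu.eq_or_lt with h0 | hpos
  · rw [← h0, C_0, sub_zero] at hr
    refine ⟨0, -r, by rw [hr]; ring, ?_⟩
    rw [eval_neg, neg_ne_zero]
    exact fun h => not_dvd_of_squarefree hq (irreducible_X_sub_C u) hr (dvd_iff_isRoot.2 h)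
  · set m := √(q.eval u) with hm
    have hm0 : 0 < m := Real.sqrt_pos.2 hpos
    have hm2 : C m ^ 2 = C (q.eval u) := by rw [← C_pow, Real.sq_sqrt hu]
    set β := (r.eval u + 1) / (2 * m) with hβ
    refine ⟨C m + C β * (X - C u), C (2 * m * β) + C β ^ 2 * (X - C u) - r, ?_, ?_⟩
    · simp only [C_mul, map_ofNat]
      linear_combination hm2 - hr
    · have : 2 * m * β = r.eval u + 1 := by rw [hβ]; field_simp
      simp [this]

/-- At a prime containing `y` and a common quadratic factor `p = (x - α)² + β²` of `q` and of the
norm of `f`, some multiplier outside the prime turns `f` into a sum of squares. -/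
theorem exists_isSumSq_mul_of_quadratic {m : Ideal (CurveRing q)} (hm : m.IsPrime)
    {α β : ℝ} (hβ : β ≠ 0) {p a b q₁ N : ℝ[X]} (hp : p = (X - C α) ^ 2 + C (β ^ 2))
    (hq : q = p * q₁) (hN : N = p * a ^ 2 + q₁ * b ^ 2)
    (hpm : AdjoinRoot.of (curvePoly q) p ∈ m)
    (hym : AdjoinRoot.root (curvePoly q) ∈ m)
    (hbq : AdjoinRoot.of (curvePoly q) (b * q₁) ∉ m) :
    ∃ t ∉ m, IsSumSq (t * curveElem q (p * a) b) := by
  set o := AdjoinRoot.of (curvePoly q) with ho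
  set y := AdjoinRoot.root (curvePoly q) with hy
  have hy2 : y ^ 2 = -(o p * o q₁) := by rw [curve_root_sq, ← map_mul, ← hq]
  have hNm : o N ∉ m := by
    intro h
    rw [hN, map_add, map_mul, m.add_mem_iff_right (m.mul_mem_right _ hpm)] at h
    apply hbq
    rw [map_mul]
    rw [map_mul, map_pow] at h
    rcases hm.mem_or_mem h with h | h
    · exact m.mul_mem_left _ h
    · exact m.mul_mem_right _ (hm.mem_of_pow_mem _ h)
  have hfbar : curveElem q (p * a) (-b) ∈ m := by
    rw [curveElem, map_mul]
    exact m.add_mem (m.mul_mem_right _ hpm) (m.mul_mem_left _ hym)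
  have hh : (o 2 : CurveRing q) = 2 := map_ofNat _ _
  set k := o (C (1 / 2)) with hk
  have hk2 : k * 2 = 1 := by
    rw [← hh, ← map_mul, ← map_one o]
    congr 1
    rw [← map_ofNat C, ← C_mul]
    norm_num
  set n := o (C (1 / β ^ 2)) with hn
  set j := o (C (1 / β) * (X - C α)) with hj
  have hj2 : j ^ 2 = o p * n - 1 := by
    rw [hj, hn, ← map_pow, ← map_mul, ← map_one o, ← map_sub]
    congr 1
    have h1 : C (1 / β) ^ 2 = C (1 / β ^ 2) := by rw [← C_pow, div_pow, one_pow]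
    have h2 : C (β ^ 2) * C (1 / β ^ 2) = 1 := by
      rw [← C_mul, mul_one_div_cancel (pow_ne_zero 2 hβ), C_1]
    rw [hp]
    linear_combination (X - C α) ^ 2 * h1 - h2
  set h := o a * y + o (b * q₁) with hhdef
  refine ⟨o N * (h + curveElem q (p * a) (-b) * (n * (k * (y - 1)) ^ 2)), ?_, ?_⟩
  · intro hmem
    rcases hm.mem_or_mem hmem with hmem | hmem
    · exact hNm hmem
    · rw [m.add_mem_iff_left (m.mul_mem_right _ hfbar), hhdef,
        m.add_mem_iff_right (m.mul_mem_left _ hym)] at hmem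
      exact hbq hmem
  · have hfh : curveElem q (p * a) b * h = o N * y := by
      rw [hhdef, curveElem, hN]
      simp only [map_add, map_mul, map_pow, ← ho, ← hy]
      linear_combination (o a * o b) * hy2
    have hff : curveElem q (p * a) b * curveElem q (p * a) (-b) = o p * o N := by
      rw [curveElem_mul_conj, ← map_mul, hN]
      congr 1
      linear_combination b ^ 2 * hq
    refine ((IsSumSq.sq (o N * (k * (y + 1)))).add (IsSumSq.sq (o N * (j * (k * (y - 1)))))).of_eq ?_
    linear_combination o N * hfh + o N * (n * (k * (y - 1)) ^ 2) * hff
      - o N ^ 2 * (k * (y - 1)) ^ 2 * hj2 - o N ^ 2 * y * (k * 2 + 1) * hk2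

/-- Every nonnegative element of the coordinate ring is a sum of squares. -/
theorem isSumSq_curveElem (hq : Squarefree q) (hmonic : q.Monic) (hdeg : q.natDegree = 4)
    (a b : ℝ[X]) (hf : ∀ φ : CurveRing q →ₐ[ℝ] ℝ, 0 ≤ φ (curveElem q a b)) :
    IsSumSq (curveElem q a b) := by
  induction hn : (a ^ 2 + q * b ^ 2).natDegree using Nat.strong_induction_on generalizing a b with
  | _ n ih =>
  set N := a ^ 2 + q * b ^ 2 with hNdef
  by_cases hN0 : N = 0
  · obtain ⟨rfl, rfl⟩ := eq_zero_of_norm_eq_zero hmonic hN0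
    exact IsSumSq.zero.of_eq (by simp [curveElem])
  have hNnn := norm_nonneg_of_psd hf
  rw [← hNdef] at hNnn
  have hconj := curveElem_mul_conj (q := q) a b
  rw [← hNdef] at hconj
  refine isSumSq_of_forall_isMaximal (sumSqBounded_curveRing hmonic hdeg) fun m hm => ?_
  have hmp := hm.isPrime
  suffices H : ∃ t ∉ m, IsSumSq (t * curveElem q a b) by
    obtain ⟨t, htm, ht⟩ := H
    refine ⟨t, htm, algHom_nonneg_of_off_zeros hq hN0 fun φ hφ => ?_, ht⟩
    have h1 := ht.map_alg_nonneg φ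
    rw [map_mul] at h1
    have h2 : φ (curveElem q a b) ≠ 0 := by
      intro h
      apply hφ
      rw [← algHom_of, ← hconj, map_mul, h, zero_mul]
    exact nonneg_of_mul_nonneg_left h1 ((hf φ).lt_of_ne' h2)
  by_cases hfm : curveElem q a b ∈ m
  swap
  · exact ⟨_, hfm, IsSumSq.mul_self _⟩
  have hNm : AdjoinRoot.of (curvePoly q) N ∈ m := hconj ▸ m.mul_mem_right _ hfm
  have h2u : (2 : CurveRing q) ∉ m := fun h => hm.ne_top <| (Ideal.eq_top_iff_one m).2 <| by
    rw [← algebraMap_half_mul_two_mul (1 : CurveRing q), mul_one]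
    exact m.mul_mem_left _ h
  by_cases ham : AdjoinRoot.of (curvePoly q) a ∈ m
  swap
  · refine ⟨2 * AdjoinRoot.of (curvePoly q) a, fun h => (hmp.mem_or_mem h).elim h2u ham, ?_⟩
    refine ((IsSumSq.sq (curveElem q a b)).add
      ((isSumSq_of_eval_nonneg hNnn).map_ringHom (AdjoinRoot.of (curvePoly q)))).of_eq ?_
    rw [← hconj]
    simp only [curveElem, map_neg]
    ring
  have h1m : (1 : CurveRing q) ∉ m := fun h => hm.ne_top ((Ideal.eq_top_iff_one m).2 h)
  obtain ⟨p, hpirr, hpgen, hpform⟩ := (hmp.comap (AdjoinRoot.of (curvePoly q))).exists_generator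
    hN0 hNm
  simp only [Ideal.mem_comap] at hpgen
  have hpm := (hpgen p).2 dvd_rfl
  obtain ⟨a', rfl⟩ := (hpgen a).1 ham
  by_cases hpb : p ∣ b
  · obtain ⟨b', rfl⟩ := hpb
    have hNN : N = p * (p * (a' ^ 2 + q * b' ^ 2)) := by rw [hNdef]; ring
    have hN'0 : a' ^ 2 + q * b' ^ 2 ≠ 0 := fun h => hN0 (by rw [hNN, h]; ring)
    have hpdeg : p.natDegree ≠ 0 := hpirr.natDegree_pos.ne'
    have hlt : (a' ^ 2 + q * b' ^ 2).natDegree < n := by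
      rw [← hn, hNN]
      exact (Polynomial.natDegree_lt_natDegree_mul hpdeg hN'0).trans
        (Polynomial.natDegree_lt_natDegree_mul hpdeg (mul_ne_zero hpirr.ne_zero hN'0))
    rcases hpform with ⟨u, hpu⟩ | ⟨α, β, hβ, hpq⟩
    · by_cases hcase : (a' ^ 2 + q * b' ^ 2).eval u = 0 ∨ q.eval u < 0
      · subst hpu
        obtain ⟨hau, hbu⟩ := eval_eq_zero_of_psd_of_norm hq hf hcase
        obtain ⟨a'', rfl⟩ := dvd_iff_isRoot.2 hau
        obtain ⟨b'', rfl⟩ := dvd_iff_isRoot.2 hbu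
        have hM : ((X - C u) * a'') ^ 2 + q * ((X - C u) * b'') ^ 2
            = (X - C u) * ((X - C u) * (a'' ^ 2 + q * b'' ^ 2)) := by ring
        have hM0 : a'' ^ 2 + q * b'' ^ 2 ≠ 0 := fun h => hN'0 (by rw [hM, h]; ring)
        have hlt' : (a'' ^ 2 + q * b'' ^ 2).natDegree < n := by
          refine lt_trans ?_ hlt
          rw [hM]
          exact (Polynomial.natDegree_lt_natDegree_mul hpdeg hM0).trans
            (Polynomial.natDegree_lt_natDegree_mul hpdeg (mul_ne_zero hpirr.ne_zero hM0))
        have hfac : curveElem q ((X - C u) * ((X - C u) * a'')) ((X - C u) * ((X - C u) * b''))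
            = AdjoinRoot.of (curvePoly q) (X - C u) ^ 2 * curveElem q a'' b'' := by
          rw [curveElem_mul_left, curveElem_mul_left, sq, mul_assoc]
        refine ⟨1, h1m, ?_⟩
        have hpsd : ∀ φ : CurveRing q →ₐ[ℝ] ℝ, 0 ≤ φ (curveElem q a'' b'') := by
          refine algHom_nonneg_of_off_zeros hq (X_sub_C_ne_zero u) fun φ hφ => ?_
          have h := hf φ
          rw [hfac, map_mul, map_pow, algHom_of] at h
          exact nonneg_of_mul_nonneg_right h (by positivity)
        exact ((IsSumSq.sq _).mul (ih _ hlt' a'' b'' hpsd rfl)).of_eq (by rw [one_mul, hfac])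
      · rw [not_or, not_lt] at hcase
        obtain ⟨g, r, hgr, hru⟩ := exists_sq_sub_simple_zero hq hcase.2
        rw [← hpu] at hgr
        have hnd : ∀ s : ℝ[X], s.eval u ≠ 0 → AdjoinRoot.of (curvePoly q) s ∉ m := fun s hs h =>
          hs (dvd_iff_isRoot.1 (hpu ▸ (hpgen s).1 h))
        have hconj' := curveElem_mul_conj (q := q) a' b'
        refine ⟨AdjoinRoot.of (curvePoly q) (r * (a' ^ 2 + q * b' ^ 2)) * curveElem q a' (-b'),
          fun h => ?_, ?_⟩
        · rcases hmp.mem_or_mem h with h | h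
          · exact hnd _ (by rw [eval_mul]; exact mul_ne_zero hru hcase.1) h
          · exact hnd _ hcase.1 (hconj' ▸ m.mul_mem_left _ h)
        · refine (((IsSumSq.sq (AdjoinRoot.root (curvePoly q))).add
            (IsSumSq.sq (AdjoinRoot.of (curvePoly q) g))).mul
            (IsSumSq.sq (AdjoinRoot.of (curvePoly q) (a' ^ 2 + q * b' ^ 2)))).of_eq ?_
          have h3 : AdjoinRoot.root (curvePoly q) ^ 2 + AdjoinRoot.of (curvePoly q) g ^ 2
              = AdjoinRoot.of (curvePoly q) p * AdjoinRoot.of (curvePoly q) r := by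
            rw [curve_root_sq, ← map_mul, ← hgr, map_sub, map_pow]
            ring
          rw [h3, curveElem_mul_left, map_mul, ← hconj']
          ring
    · refine ⟨1, h1m, ?_⟩
      have hpos : ∀ x, 0 < p.eval x := fun x => by
        rw [hpq]
        simp only [eval_add, eval_pow, eval_sub, eval_X, eval_C]
        positivity
      have hpsd : ∀ φ : CurveRing q →ₐ[ℝ] ℝ, 0 ≤ φ (curveElem q a' b') := by
        intro φ
        have h := hf φ
        rw [curveElem_mul_left, map_mul, algHom_of] at h
        exact nonneg_of_mul_nonneg_right h (hpos _)
      exact (((isSumSq_of_eval_nonneg fun x => (hpos x).le).map_ringHom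
        (AdjoinRoot.of (curvePoly q))).mul (ih _ hlt a' b' hpsd rfl)).of_eq
        (by rw [one_mul, curveElem_mul_left])
  · have hym : AdjoinRoot.root (curvePoly q) ∈ m := by
      rw [curveElem, m.add_mem_iff_right ham] at hfm
      exact (hmp.mem_or_mem hfm).resolve_left fun h => hpb ((hpgen b).1 h)
    have hqm : AdjoinRoot.of (curvePoly q) q ∈ m := by
      rw [← neg_neg (AdjoinRoot.of (curvePoly q) q), ← curve_root_sq, sq]
      exact m.neg_mem (m.mul_mem_right _ hym)
    obtain ⟨q₁, hq₁⟩ := (hpgen q).1 hqm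
    have hpq₁ := not_dvd_of_squarefree hq hpirr hq₁
    have hpprime := hpirr.prime
    rcases hpform with ⟨u, hpu⟩ | ⟨α, β, hβ, hpq⟩
    · exfalso
      have h0 : (p * a' ^ 2 + q₁ * b ^ 2).eval u = 0 := by
        refine eval_eq_zero_of_sub_mul_nonneg (Eventually.of_forall fun x => ?_)
        refine (hNnn x).trans_eq ?_
        rw [hNdef, hq₁, hpu]
        simp only [eval_add, eval_mul, eval_pow, eval_sub, eval_X, eval_C]
        ring
      have hdvd : p ∣ p * a' ^ 2 + q₁ * b ^ 2 := by
        rw [hpu] at h0 ⊢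
        exact dvd_iff_isRoot.2 h0
      rcases hpprime.dvd_or_dvd ((dvd_add_right (dvd_mul_right p _)).1 hdvd) with h | h
      · exact hpq₁ h
      · exact hpb (hpprime.dvd_of_dvd_pow h)
    · refine exists_isSumSq_mul_of_quadratic hmp hβ hpq hq₁ rfl hpm hym fun h => ?_
      exact (hpprime.dvd_or_dvd ((hpgen _).1 h)).elim hpb hpq₁

end Curve

theorem IsSumSq.exists_sum_sq {R : Type*} [CommRing R] {a : R} (ha : IsSumSq a) :
    ∃ (r : ℕ) (g : Fin r → R), a = ∑ i, g i ^ 2 := by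
  induction ha with
  | zero => exact ⟨0, Fin.elim0, by simp⟩
  | sq_add b _ ih =>
    obtain ⟨r, g, hg⟩ := ih
    exact ⟨r + 1, Fin.cons b g, by
      rw [Fin.sum_univ_succ, hg, ← pow_two]
      simp⟩

theorem Polynomial.squarefree_of_map {q : ℝ[X]} (h : Squarefree (q.map (algebraMap ℝ ℂ))) :
    Squarefree q := fun p hp => by
  have hp' := h (p.map (algebraMap ℝ ℂ)) (by
    rw [← Polynomial.map_mul]
    exact Polynomial.map_dvd _ hp)
  rw [Polynomial.isUnit_iff_degree_eq_zero] at hp' ⊢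
  rwa [degree_map] at hp'

/-- every psd element of `ℝ[C]` is a sum of squares in `ℝ[C]`. -/
theorem psd_eq_sos_on_genus_one_curve
    (q : Polynomial ℝ) (hmonic : q.Monic) (hdeg : q.natDegree = 4)
    (hsep : Squarefree (q.map (algebraMap ℝ ℂ)))
    (hindef : ∃ x : ℝ, q.eval x < 0)
    (f : CurveRing q) (hf : IsPsd q f) :
    ∃ (r : ℕ) (g : Fin r → CurveRing q), f = ∑ i, g i ^ 2 := by
  apply IsSumSq.exists_sum_sq
  rw [← curveElem_rep f]
  refine isSumSq_curveElem (squarefree_of_map hsep) hmonic hdeg _ _ fun φ => ?_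
  have h := hf _ _ (algHom_root φ)
  rwa [← algHom_of φ, ← algHom_of φ, ← map_mul, ← map_add] at h

end
end

section
/- Let A be a commutative ℝ-algebra and s ∈ A. Assume: (i) every psd element of A is a sum of squares in A; (ii) the cone of sums of squares of A is stable; (iii) every g ∈ A such that φ(g) ≥ 0 for all ℝ-algebra homomorphisms φ : A → ℝ with φ(s) ≠ 0 is psd. Then the cone of sums of squares of the localization A_s is stable: for every finite-dimensional ℝ-linear subspace L′ of A_s there is a finite-dimensional subspace W′ of A_s such that every element of L′ that is a sum of squares in A_s is a sum of squares of elements of W′. -/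
noncomputable section

/-- `f` is a sum of squares in the commutative ring `A`. -/
def IsSumOfSquares {A : Type*} [CommRing A] (f : A) : Prop :=
  ∃ (r : ℕ) (g : Fin r → A), f = ∑ i, g i ^ 2

/-- `f` is a sum of squares of elements of the subspace `W`. -/
def IsSumOfSquaresFrom {A : Type*} [CommRing A] [Algebra ℝ A]
    (W : Submodule ℝ A) (f : A) : Prop :=
  ∃ (r : ℕ) (g : Fin r → A), (∀ i, g i ∈ W) ∧ f = ∑ i, g i ^ 2

/-- The cone of sums of squares of the `ℝ`-algebra `A` is stable. -/
def SosStable (A : Type*) [CommRing A] [Algebra ℝ A] : Prop :=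
  ∀ L : Submodule ℝ A, FiniteDimensional ℝ L →
    ∃ W : Submodule ℝ A, FiniteDimensional ℝ W ∧
      ∀ f ∈ L, IsSumOfSquares f → IsSumOfSquaresFrom W f

/-- Lemma 2.4 / `redlem`: if every psd element of `A` is a sum of
squares, the sums-of-squares cone of `A` is stable, and psd-ness on `A` can be tested
on homomorphisms not vanishing at `s`, then the sums-of-squares cone of the
localization `A_s` is stable. -/
theorem sos_stability_descends_to_localization
    (A : Type*) [CommRing A] [Algebra ℝ A] (s : A)
    (hpsd_sos : ∀ f : A, (∀ φ : A →ₐ[ℝ] ℝ, 0 ≤ φ f) → IsSumOfSquares f)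
    (hstable : SosStable A)
    (hdense : ∀ g : A, (∀ φ : A →ₐ[ℝ] ℝ, φ s ≠ 0 → 0 ≤ φ g) →
      ∀ φ : A →ₐ[ℝ] ℝ, 0 ≤ φ g) :
    SosStable (Localization.Away s) := by
  intro L' hL'
  set ι := IsScalarTower.toAlgHom ℝ A (Localization.Away s) with hι
  obtain ⟨S, hS⟩ := (Submodule.fg_iff_finiteDimensional L').2 hL'
  obtain ⟨⟨_, k, rfl⟩, hk⟩ :=
    IsLocalization.exist_integer_multiples_of_finset (Submonoid.powers s) S
  choose! lift hlift using hk
  have hunit : IsUnit (ι s) := IsLocalization.Away.algebraMap_isUnit s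
  obtain ⟨u, hu⟩ := hunit
  let L : Submodule ℝ A := Submodule.span ℝ ((fun x => s ^ k * lift x) '' (S : Set _))
  have hL : FiniteDimensional ℝ L :=
    FiniteDimensional.span_of_finite ℝ (S.finite_toSet.image _)
  have hle : L' ≤ (L.map ι.toLinearMap).comap (LinearMap.mulLeft ℝ (ι s ^ (2 * k))) := by
    rw [← hS, Submodule.span_le]
    intro x hx
    refine ⟨s ^ k * lift x, Submodule.subset_span ⟨x, hx, rfl⟩, ?_⟩
    have h : ι (lift x) = ι s ^ k * x := by
      have := hlift x hx
      rw [Algebra.smul_def] at this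
      rw [← map_pow]
      exact this
    change ι (s ^ k * lift x) = ι s ^ (2 * k) * x
    rw [map_mul, map_pow, h]
    ring
  obtain ⟨W, hW, hWsos⟩ := hstable L hL
  let inv : Localization.Away s := ↑(u⁻¹) ^ k
  have hinv : inv * ι s ^ k = 1 := by
    rw [← hu, ← mul_pow, Units.inv_mul, one_pow]
  refine ⟨W.map ((LinearMap.mulLeft ℝ inv).comp ι.toLinearMap), inferInstance, ?_⟩
  rintro f hf ⟨r, g, hg⟩
  obtain ⟨a, haL, ha⟩ := hle hf
  replace ha : ι a = ι s ^ (2 * k) * f := ha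
  have hsos : IsSumOfSquares a := by
    refine hpsd_sos a (hdense a fun φ hφ => ?_)
    let ψ : Localization.Away s →+* ℝ :=
      IsLocalization.Away.lift s (g := φ.toRingHom) (isUnit_iff_ne_zero.2 hφ)
    have hψ (x : A) : ψ (ι x) = φ x := IsLocalization.Away.lift_eq s _ x
    rw [← hψ, ha, hg, map_mul, map_pow, map_sum, pow_mul']
    simp only [map_pow]
    positivity
  obtain ⟨n, w, hw, haw⟩ := hWsos a haL hsos
  refine ⟨n, fun i => inv * ι (w i), fun i => ⟨w i, hw i, rfl⟩, ?_⟩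
  calc f = (inv * ι s ^ k) ^ 2 * f := by rw [hinv, one_pow, one_mul]
    _ = inv ^ 2 * ι a := by rw [ha]; ring
    _ = ∑ i, (inv * ι (w i)) ^ 2 := by
      simp only [haw, map_sum, map_pow, Finset.mul_sum, mul_pow]

end
end
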